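/- arXiv:2602.05740 — 2 statements merged into one kernel-verified Lean document; each statement's English description precedes it below -/
import Mathlib

section
/- Let n ≥ 1 be real and let X be a nonempty complete proper geodesic metric space with a local Busemann–MCP(K,n) structure for the n-dimensional Hausdorff measure μH n, where K ≤ 0. Then there exists k ∈ ℕ with (k : ℝ) = n such that the set of k-manifold points of X is open and dense in X and its complement has μH n-measure zero. -/
open Metric MeasureTheory ENNReal Filter

/-- A geodesic structure on a subset `U` of a metric space: a map `σ` defined on all of `X`
whose geodesic properties hold for points of `U`, and which maps `U` into itself. -/
structure LocalGeodesicStructure (X : Type*) [MetricSpace X] (U : Set X) where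
  σ : X → X → ℝ → X
  σ_mem : ∀ x ∈ U, ∀ y ∈ U, ∀ t ∈ Set.Icc (0:ℝ) 1, σ x y t ∈ U
  σ_zero : ∀ x ∈ U, ∀ y ∈ U, σ x y 0 = x
  σ_one : ∀ x ∈ U, ∀ y ∈ U, σ x y 1 = y
  dist_σ : ∀ x ∈ U, ∀ y ∈ U, ∀ s ∈ Set.Icc (0:ℝ) 1, ∀ t ∈ Set.Icc (0:ℝ) 1,
    dist (σ x y s) (σ x y t) = |s - t| * dist x y
  σ_comp : ∀ x ∈ U, ∀ y ∈ U, ∀ s ∈ Set.Icc (0:ℝ) 1, ∀ t ∈ Set.Icc (0:ℝ) 1,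
    σ x (σ x y t) s = σ x y (s * t)

/-- The integrand of the MCP(K,N) condition; for `K = 0` or `N = 1` it is interpreted
as `t ^ N`. -/
noncomputable def mcpCoeff (K N t d : ℝ) : ℝ :=
  if K = 0 ∨ N = 1 then t ^ N
  else t * (Real.sinh (t * d * Real.sqrt (-K / (N - 1))) /
      Real.sinh (d * Real.sqrt (-K / (N - 1)))) ^ (N - 1)

/-- `X` carries a local Busemann–MCP(K,N) structure for the Borel measure `m`:
`m` is locally finite and positive on nonempty open sets, and every point has an open ball
around it carrying a Busemann convex geodesic structure satisfying the MCP(K,N) inequality. -/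
def LocalBusemannMCP (X : Type*) [MetricSpace X] [MeasurableSpace X]
    (m : Measure X) (K N : ℝ) : Prop :=
  IsLocallyFiniteMeasure m ∧ m.IsOpenPosMeasure ∧
    ∀ z : X, ∃ r : ℝ, 0 < r ∧ ∃ L : LocalGeodesicStructure X (ball z r),
      (∀ p ∈ ball z r, ∀ x ∈ ball z r, ∀ y ∈ ball z r, ∀ t ∈ Set.Icc (0:ℝ) 1,
        dist (L.σ p x t) (L.σ p y t) ≤ t * dist x y) ∧
      (∀ p ∈ ball z r, ∀ A : Set X, A ⊆ ball z r → MeasurableSet A →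
        ∀ t ∈ Set.Icc (0:ℝ) 1,
          (∫⁻ a in A, ENNReal.ofReal (mcpCoeff K N t (dist p a)) ∂m) ≤
            m ((fun a => L.σ p a t) '' A))

/-- `X` is a geodesic metric space: any two points are joined by a shortest path. -/
def IsGeodesicMetricSpace (X : Type*) [MetricSpace X] : Prop :=
  ∀ x y : X, ∃ g : ℝ → X, g 0 = x ∧ g (dist x y) = y ∧
    ∀ s ∈ Set.Icc 0 (dist x y), ∀ t ∈ Set.Icc 0 (dist x y), dist (g s) (g t) = |s - t|

/-- A point `p` is a `k`-manifold point if it has an open neighborhood homeomorphic to `ℝ^k`. -/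
def IsManifoldPoint {X : Type*} [TopologicalSpace X] (k : ℕ) (p : X) : Prop :=
  ∃ U : Set X, IsOpen U ∧ p ∈ U ∧ Nonempty (U ≃ₜ (Fin k → ℝ))

/-! ### Metric spaces with radial dilations -/

namespace BusemannMCP

theorem perm_apply_inv {α : Type*} (φ : Equiv.Perm α) (y : α) : φ (φ⁻¹ y) = y :=
  Equiv.apply_symm_apply φ y

theorem perm_inv_apply {α : Type*} (φ : Equiv.Perm α) (y : α) : φ⁻¹ (φ y) = y :=
  Equiv.symm_apply_apply φ y

theorem pow_apply_eq_self {α : Type*} {φ : Equiv.Perm α} {c : α} (h : φ c = c) (k : ℕ) :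
    (φ ^ k) c = c := by
  induction k with
  | zero => simp
  | succ k ih => rw [pow_succ', Equiv.Perm.mul_apply, ih, h]

/-- A bijective dilation with centre `c` and ratio `a` which moves every point as little as
possible. -/
structure IsRadialDilation {T : Type*} [MetricSpace T] (c : T) (a : ℝ) (φ : Equiv.Perm T) :
    Prop where
  dist_map : ∀ y z, dist (φ y) (φ z) = a * dist y z
  map_center : φ c = c
  dist_self : ∀ y, dist y (φ y) = (1 - a) * dist c y

/-- A `1`-Lipschitz function which is convex along all radial dilations. -/
structure DilationConvex {T : Type*} [MetricSpace T] (f : T → ℝ) : Prop where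
  lip : ∀ y z, f y - f z ≤ dist y z
  conv : ∀ c a φ, 0 < a → a < 1 → IsRadialDilation c a φ →
    ∀ y, f (φ y) ≤ (1 - a) * f c + a * f y

section Dilation

variable {T : Type*} [MetricSpace T]

theorem IsRadialDilation.conj {c : T} {a b : ℝ} {φ ψ : Equiv.Perm T}
    (hφ : IsRadialDilation c a φ) (hψ : ∀ y z, dist (ψ y) (ψ z) = b * dist y z) :
    IsRadialDilation (ψ c) a (ψ * φ * ψ⁻¹) where
  dist_map y z := by
    have h1 := hψ (ψ⁻¹ y) (ψ⁻¹ z)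
    simp only [perm_apply_inv] at h1
    simp only [Equiv.Perm.mul_apply, hψ, hφ.dist_map, h1]
    ring
  map_center := by simp [hφ.map_center]
  dist_self y := by
    have h1 := hψ (ψ⁻¹ y) (φ (ψ⁻¹ y))
    have h2 := hψ c (ψ⁻¹ y)
    simp only [perm_apply_inv] at h1 h2
    simp only [Equiv.Perm.mul_apply, h1, hφ.dist_self, h2]
    ring

theorem dilation_pow {φ : Equiv.Perm T} {a : ℝ} (h : ∀ y z, dist (φ y) (φ z) = a * dist y z)
    (k : ℕ) (y z : T) : dist ((φ ^ k) y) ((φ ^ k) z) = a ^ k * dist y z := by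
  induction k with
  | zero => simp
  | succ k ih => rw [pow_succ', Equiv.Perm.mul_apply, Equiv.Perm.mul_apply, h, ih]; ring

theorem dilation_inv {φ : Equiv.Perm T} {a : ℝ} (ha : a ≠ 0)
    (h : ∀ y z, dist (φ y) (φ z) = a * dist y z) (y z : T) :
    dist (φ⁻¹ y) (φ⁻¹ z) = a⁻¹ * dist y z := by
  have := h (φ⁻¹ y) (φ⁻¹ z)
  simp only [perm_apply_inv] at this
  rw [this]; field_simp

theorem dilationConvex_dist (p : T) : DilationConvex (fun y => dist p y) where
  lip y z := by
    have := dist_triangle p z y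
    rw [dist_comm z y] at this
    linarith
  conv c a φ ha ha1 hφ y := by
    have h1 := dist_triangle p (φ p) (φ y)
    rw [hφ.dist_self, hφ.dist_map, dist_comm c p] at h1
    exact h1

theorem DilationConvex.comp_dilation {f : T → ℝ} (hf : DilationConvex f) {ψ : Equiv.Perm T} {b : ℝ}
    (hb : 0 < b) (hψ : ∀ y z, dist (ψ y) (ψ z) = b * dist y z) (e : ℝ) :
    DilationConvex (fun y => f (ψ y) / b + e) where
  lip y z := by
    have h1 := hf.lip (ψ y) (ψ z)
    rw [hψ] at h1
    have : f (ψ y) / b + e - (f (ψ z) / b + e) = (f (ψ y) - f (ψ z)) / b := by ring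
    rw [this, div_le_iff₀ hb]
    linarith
  conv c a φ ha ha1 hφ y := by
    have h1 := hf.conv _ a _ ha ha1 (hφ.conj hψ) (ψ y)
    simp only [Equiv.Perm.mul_apply, perm_inv_apply] at h1
    have h2 : (1 - a) * (f (ψ c) / b + e) + a * (f (ψ y) / b + e)
        = ((1 - a) * f (ψ c) + a * f (ψ y)) / b + e := by ring
    rw [h2]
    gcongr

theorem DilationConvex.of_tendsto {f : ℕ → T → ℝ} {g : T → ℝ} (hf : ∀ k, DilationConvex (f k))
    (h : ∀ y, Tendsto (fun k => f k y) atTop (nhds (g y))) : DilationConvex g where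
  lip y z := le_of_tendsto' ((h y).sub (h z)) fun k => (hf k).lip y z
  conv c a φ ha ha1 hφ y := le_of_tendsto_of_tendsto' (h (φ y))
    (((h c).const_mul _).add ((h y).const_mul _)) fun k => (hf k).conv c a φ ha ha1 hφ y

theorem DilationConvex.exists_blowup {g : T → ℝ} (hg : DilationConvex g) {z : T} {a : ℝ}
    {φ : Equiv.Perm T} (ha : 0 < a) (ha1 : a < 1) (hφ : IsRadialDilation z a φ) :
    ∃ h : T → ℝ, DilationConvex h ∧ (∀ y, h y ≤ g y) ∧ h z = g z ∧
      ∀ y, h (φ y) - h z = a * (h y - h z) := by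
  set s : ℕ → T → ℝ := fun k y => g ((φ ^ k) y) / a ^ k + (g z - g z / a ^ k) with hs
  have hs' : ∀ k y, s k y = g z + (g ((φ ^ k) y) - g z) / a ^ k := fun k y => by
    simp only [hs]; ring
  have hconv : ∀ k, DilationConvex (s k) := fun k =>
    hg.comp_dilation (pow_pos ha k) (dilation_pow hφ.dist_map k) _
  have hsucc : ∀ k y, s k (φ y) - g z = a * (s (k + 1) y - g z) := fun k y => by
    rw [hs', hs', pow_succ φ k, Equiv.Perm.mul_apply, pow_succ]
    field_simp
    ring
  have hz : ∀ k, s k z = g z := fun k => by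
    rw [hs', pow_apply_eq_self hφ.map_center]; simp
  have hanti : ∀ y, Antitone fun k => s k y := fun y => antitone_nat_of_succ_le fun k => by
    have h1 := (hconv k).conv z a φ ha ha1 hφ y
    rw [hz] at h1
    have h2 := hsucc k y
    have h3 : a * s (k + 1) y ≤ a * s k y := by linarith
    exact le_of_mul_le_mul_left h3 ha
  have hbdd : ∀ y, BddBelow (Set.range fun k => s k y) := fun y =>
    ⟨g z - dist z y, by
      rintro _ ⟨k, rfl⟩
      have := (hconv k).lip z y
      rw [hz] at this
      simp only
      linarith⟩
  have hlim : ∀ y, Tendsto (fun k => s k y) atTop (nhds (⨅ k, s k y)) := fun y =>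
    tendsto_atTop_ciInf (hanti y) (hbdd y)
  have hhz : (⨅ k, s k z) = g z := by simp [hz]
  refine ⟨fun y => ⨅ k, s k y, DilationConvex.of_tendsto hconv hlim, fun y => ?_, hhz, fun y => ?_⟩
  · refine (ciInf_le (hbdd y) 0).trans ?_
    simp [hs]
  · simp only [hhz]
    refine tendsto_nhds_unique ((hlim (φ y)).sub_const (g z)) ?_
    have := ((((hlim y).comp (tendsto_add_atTop_nat 1)).sub_const (g z)).const_mul a)
    exact this.congr fun k => (hsucc k y).symm

theorem DilationConvex.exists_blowdown {h : T → ℝ} (hh : DilationConvex h) {q : T} {a : ℝ}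
    {ψ : Equiv.Perm T} (ha : 0 < a) (ha1 : a < 1) (hψ : IsRadialDilation q a ψ) :
    ∃ e : T → ℝ, DilationConvex e ∧ (∀ y, h y - h q ≤ e y) ∧ e q = 0 ∧
      (∀ y, e (ψ y) = a * e y) ∧
      ∀ g : T → ℝ, (∀ y, h y ≤ g y) → (∀ y, g (ψ y) = a * g y) → ∀ y, e y ≤ g y := by
  set s : ℕ → T → ℝ := fun k y => h ((ψ⁻¹ ^ k) y) / a⁻¹ ^ k + (- h q / a⁻¹ ^ k) with hs
  have hs' : ∀ k y, s k y = (h ((ψ⁻¹ ^ k) y) - h q) * a ^ k := fun k y => by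
    simp only [hs, inv_pow, div_inv_eq_mul]; ring
  have hq : ψ⁻¹ q = q := by rw [Equiv.Perm.inv_eq_iff_eq, hψ.map_center]
  have hconv : ∀ k, DilationConvex (s k) := fun k =>
    hh.comp_dilation (pow_pos (inv_pos.2 ha) k)
      (dilation_pow (dilation_inv ha.ne' hψ.dist_map) k) _
  have hsucc : ∀ k y, s (k + 1) (ψ y) = a * s k y := fun k y => by
    rw [hs', hs', pow_succ ψ⁻¹ k, Equiv.Perm.mul_apply, perm_inv_apply, pow_succ]
    ring
  have hz : ∀ k, s k q = 0 := fun k => by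
    rw [hs', pow_apply_eq_self hq]; simp
  have hmono : ∀ y, Monotone fun k => s k y := fun y => monotone_nat_of_le_succ fun k => by
    have h1 := (hconv (k + 1)).conv q a ψ ha ha1 hψ y
    rw [hz, hsucc] at h1
    have h3 : a * s k y ≤ a * s (k + 1) y := by linarith
    exact le_of_mul_le_mul_left h3 ha
  have hbdd : ∀ y, BddAbove (Set.range fun k => s k y) := fun y =>
    ⟨dist y q, by
      rintro _ ⟨k, rfl⟩
      have := (hconv k).lip y q
      rw [hz] at this
      simp only
      linarith⟩
  have hlim : ∀ y, Tendsto (fun k => s k y) atTop (nhds (⨆ k, s k y)) := fun y =>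
    tendsto_atTop_ciSup (hmono y) (hbdd y)
  refine ⟨fun y => ⨆ k, s k y, DilationConvex.of_tendsto hconv hlim, fun y => ?_, by simp [hz],
    fun y => ?_, fun g hg hgψ y => ?_⟩
  · refine le_trans ?_ (le_ciSup (hbdd y) 0)
    simp [hs']
  · refine tendsto_nhds_unique ((hlim (ψ y)).comp (tendsto_add_atTop_nat 1)) ?_
    exact ((hlim y).const_mul a).congr fun k => (hsucc k y).symm
  · have hg' : ∀ k y, g ((ψ⁻¹ ^ k) y) * a ^ k = g y := by
      intro k
      induction k with
      | zero => simp
      | succ k ih =>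
        intro y
        have h1 := hgψ (ψ⁻¹ y)
        rw [perm_apply_inv] at h1
        rw [pow_succ ψ⁻¹, Equiv.Perm.mul_apply, pow_succ, ← mul_assoc, ih, h1]
        ring
    have h0 : Tendsto (fun k : ℕ => g y - h q * a ^ k) atTop (nhds (g y - h q * 0)) :=
      ((tendsto_pow_atTop_nhds_zero_of_lt_one ha.le ha1).const_mul _).const_sub _
    have := le_of_tendsto_of_tendsto' (hlim y) h0 fun k => by
      rw [hs', ← hg' k y]
      have := mul_le_mul_of_nonneg_right (hg ((ψ⁻¹ ^ k) y)) (pow_pos ha k).le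
      linarith
    simpa using this

/-- The homogeneous convex functions at the centre of a radial dilation. -/
def homogeneousConvex (q : T) (a : ℝ) (ψ : Equiv.Perm T) : Set (T → ℝ) :=
  {g | DilationConvex g ∧ g q = 0 ∧ ∀ y, g (ψ y) = a * g y}

theorem affine_of_minimal {q : T} {a : ℝ} {ψ : Equiv.Perm T} (ha : 0 < a) (ha1 : a < 1)
    (hψ : IsRadialDilation q a ψ) {g : T → ℝ} (hg : g ∈ homogeneousConvex q a ψ)
    (hmin : ∀ f ∈ homogeneousConvex q a ψ, (∀ y, f y ≤ g y) → f = g)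
    {z : T} {b : ℝ} {φ : Equiv.Perm T} (hb : 0 < b) (hb1 : b < 1) (hφ : IsRadialDilation z b φ)
    (y : T) : g (φ y) = (1 - b) * g z + b * g y := by
  obtain ⟨h, hh, hle, hhz, hhom⟩ := hg.1.exists_blowup hb hb1 hφ
  obtain ⟨e, he, hhe, heq, hehom, heg⟩ := hh.exists_blowdown ha ha1 hψ
  have heq' : e = g := hmin e ⟨he, heq, hehom⟩ (heg g hle hg.2.2)
  have hq : h q = 0 := by
    have h1 := hhe z
    have h2 := hle q
    rw [heq', hhz] at h1
    rw [hg.2.1] at h2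
    linarith
  obtain ⟨f, hf, hfle, hfq, hfhom⟩ := hh.exists_blowup ha ha1 hψ
  rw [hfq, hq] at hfhom
  have hfg : f = g := hmin f ⟨hf, by rw [hfq, hq], fun y => by simpa using hfhom y⟩
    fun y => (hfle y).trans (hle y)
  have hhg : h = g := funext fun y => le_antisymm (hle y) (hfg ▸ hfle y)
  subst hhg
  have := hhom y
  linarith

theorem exists_minimal_homogeneousConvex {q : T} {a : ℝ} {ψ : Equiv.Perm T}
    {f : T → ℝ} (hf : f ∈ homogeneousConvex q a ψ) :
    ∃ g ∈ homogeneousConvex q a ψ, (∀ y, g y ≤ f y) ∧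
      ∀ f ∈ homogeneousConvex q a ψ, (∀ y, f y ≤ g y) → f = g := by
  have key := zorn_le_nonempty₀ (α := (T → ℝ)ᵒᵈ)
    (OrderDual.ofDual ⁻¹' homogeneousConvex q a ψ) ?_ (OrderDual.toDual f) hf
  · obtain ⟨g, hfg, hg⟩ := key
    exact ⟨OrderDual.ofDual g, hg.1, hfg, fun f' hf' hle =>
      le_antisymm hle (hg.2 (y := OrderDual.toDual f') hf' hle)⟩
  · intro C hC hchain g0 hg0
    have : Nonempty C := ⟨⟨g0, hg0⟩⟩
    let F : C → T → ℝ := fun g => OrderDual.ofDual g.1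
    have hF : ∀ g : C, F g ∈ homogeneousConvex q a ψ := fun g => hC g.2
    have hbdd : ∀ y, BddBelow (Set.range fun g => F g y) := fun y => ⟨-dist q y, by
      rintro _ ⟨g, rfl⟩
      have := (hF g).1.lip q y
      rw [(hF g).2.1] at this
      simp only
      linarith⟩
    refine ⟨OrderDual.toDual fun y => ⨅ g, F g y, ⟨⟨fun y z => ?_, ?_⟩, ?_, fun y => ?_⟩, ?_⟩
    · change (⨅ g, F g y) - (⨅ g, F g z) ≤ dist y z
      rw [sub_le_comm]
      refine le_ciInf fun g => ?_
      have := ciInf_le (hbdd y) g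
      have := (hF g).1.lip y z
      linarith
    · intro c b φ hb hb1 hφ y
      change (⨅ g, F g (φ y)) ≤ (1 - b) * (⨅ g, F g c) + b * (⨅ g, F g y)
      refine le_of_forall_pos_le_add fun ε hε => ?_
      obtain ⟨g1, hg1⟩ := exists_lt_of_ciInf_lt (lt_add_of_pos_right (⨅ g, F g c) hε)
      obtain ⟨g2, hg2⟩ := exists_lt_of_ciInf_lt (lt_add_of_pos_right (⨅ g, F g y) hε)
      obtain ⟨g, hgc, hgy⟩ : ∃ g : C, F g c < (⨅ g, F g c) + ε ∧ F g y < (⨅ g, F g y) + ε := by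
        rcases hchain.total g1.2 g2.2 with h12 | h12
        · exact ⟨g2, (h12 c).trans_lt hg1, hg2⟩
        · exact ⟨g1, hg1, (h12 y).trans_lt hg2⟩
      have h1 := (hF g).1.conv c b φ hb hb1 hφ y
      have h2 := ciInf_le (hbdd (φ y)) g
      nlinarith
    · change (⨅ g, F g q) = 0
      simp [fun g => (hF g).2.1]
    · change (⨅ g, F g (ψ y)) = a * ⨅ g, F g y
      by_cases ha : 0 ≤ a
      · rw [Real.mul_iInf_of_nonneg ha]
        simp only [fun g => (hF g).2.2]
      · have h0 : ∀ g, F g y = F ⟨g0, hg0⟩ y := fun g => by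
          have aux : ∀ g g' : C, (∀ y, F g y ≤ F g' y) → F g y = F g' y := fun g g' h => by
            refine le_antisymm (h y) ?_
            have := h (ψ y)
            rw [(hF g).2.2, (hF g').2.2] at this
            nlinarith
          rcases hchain.total g.2 hg0 with h12 | h12
          · exact (aux ⟨g0, hg0⟩ g h12).symm
          · exact aux g ⟨g0, hg0⟩ h12
        simp only [fun g => (hF g).2.2, h0, ciInf_const]
    · intro g hg y
      exact ciInf_le (hbdd y) ⟨g, hg⟩

theorem exists_affine_norming
    (H : ∀ (c : T) (a : ℝ), 0 < a → a < 1 → ∃ φ, IsRadialDilation c a φ) (p q : T) :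
    ∃ g : T → ℝ, (∀ y z, g y - g z ≤ dist y z) ∧
      (∀ z b φ, 0 < b → b < 1 → IsRadialDilation z b φ → ∀ y, g (φ y) = (1 - b) * g z + b * g y) ∧
      g q - g p = dist p q := by
  obtain ⟨ψ, hψ⟩ := H q (1 / 2) (by norm_num) (by norm_num)
  obtain ⟨h, hh, hle, hhq, hhom⟩ :=
    (dilationConvex_dist p).exists_blowup (by norm_num) (by norm_num) hψ
  have h1 : (fun y => h y - h q) ∈ homogeneousConvex q (1 / 2) ψ := by
    refine ⟨?_, by simp, fun y => by simpa using hhom y⟩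
    simpa [sub_eq_add_neg] using
      hh.comp_dilation (ψ := 1) (b := 1) one_pos (by simp) (-h q)
  obtain ⟨g, hg, hgle, hmin⟩ := exists_minimal_homogeneousConvex h1
  refine ⟨g, hg.1.lip, fun z b φ hb hb1 hφ y =>
    affine_of_minimal (by norm_num) (by norm_num) hψ hg hmin hb hb1 hφ y, ?_⟩
  refine le_antisymm ((hg.1.lip q p).trans_eq (dist_comm _ _)) ?_
  have h2 := hgle p
  have h3 := hle p
  simp only [hhq, dist_self] at h2 h3
  rw [hg.2.1]
  linarith

/-- A metric space in which every point is the centre of radial dilations of all ratios is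
isometric to a normed space. -/
theorem exists_isometryEquiv_normedSpace {T : Type u} [MetricSpace T] (o : T)
    (H : ∀ (c : T) (a : ℝ), 0 < a → a < 1 → ∃ φ, IsRadialDilation c a φ) :
    ∃ (E : Type u) (_ : NormedAddCommGroup E) (_ : NormedSpace ℝ E) (Φ : T ≃ᵢ E), Φ o = 0 := by
  let 𝒜 : Type u := {g : T → ℝ // (∀ y z, g y - g z ≤ dist y z) ∧
    (∀ z b φ, 0 < b → b < 1 → IsRadialDilation z b φ → ∀ y, g (φ y) = (1 - b) * g z + b * g y) ∧
    g o = 0}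
  have hlip : ∀ (g : 𝒜) y z, |g.1 y - g.1 z| ≤ dist y z := fun g y z => by
    rw [abs_le]
    constructor
    · have := g.2.1 z y
      rw [dist_comm] at this
      linarith
    · exact g.2.1 y z
  have hnorming : ∀ p q, ∃ g : 𝒜, g.1 q - g.1 p = dist p q := fun p q => by
    obtain ⟨g, h1, h2, h3⟩ := exists_affine_norming H p q
    refine ⟨⟨fun y => g y - g o, fun y z => ?_, fun z b φ hb hb1 hφ y => ?_, by simp⟩, ?_⟩
    · linarith [h1 y z]
    · simp only [h2 z b φ hb hb1 hφ y]; ring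
    · simp only
      linarith
  let F : T → lp (fun _ : 𝒜 => ℝ) ∞ := fun y => ⟨fun g => g.1 y, by
    refine memℓp_infty ⟨dist y o, ?_⟩
    rintro _ ⟨g, rfl⟩
    have := hlip g y o
    rw [g.2.2.2, sub_zero] at this
    exact this⟩
  have hF : ∀ y g, F y g = g.1 y := fun _ _ => rfl
  have hiso : Isometry F := Isometry.of_dist_eq fun y z => by
    rw [dist_eq_norm]
    refine le_antisymm (lp.norm_le_of_forall_le dist_nonneg fun g => hlip g y z) ?_
    obtain ⟨g, hg⟩ := hnorming z y
    have := lp.norm_apply_le_norm ENNReal.top_ne_zero (F y - F z) g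
    refine le_trans ?_ this
    rw [dist_comm, ← hg]
    exact le_abs_self _
  have hF0 : F o = 0 := by
    ext g
    exact g.2.2.2
  have haff : ∀ z b φ, 0 < b → b < 1 → IsRadialDilation z b φ → ∀ y,
      F (φ y) = (1 - b) • F z + b • F y := fun z b φ hb hb1 hφ y => by
    ext g
    exact g.2.2.1 z b φ hb hb1 hφ y
  have hsmul_lt : ∀ b : ℝ, 0 < b → b < 1 → ∀ y, b • F y ∈ Set.range F := fun b hb hb1 y => by
    obtain ⟨φ, hφ⟩ := H o b hb hb1
    exact ⟨φ y, by rw [haff o b φ hb hb1 hφ, hF0]; simp⟩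
  have hsmul_gt : ∀ b : ℝ, 1 < b → ∀ y, b • F y ∈ Set.range F := fun b hb y => by
    have hb0 : 0 < b := by linarith
    obtain ⟨φ, hφ⟩ := H o b⁻¹ (inv_pos.2 hb0) (inv_lt_one_of_one_lt₀ hb)
    refine ⟨φ⁻¹ y, ?_⟩
    have := haff o b⁻¹ φ (inv_pos.2 hb0) (inv_lt_one_of_one_lt₀ hb) hφ (φ⁻¹ y)
    rw [perm_apply_inv, hF0, smul_zero, zero_add] at this
    rw [this, smul_smul, mul_inv_cancel₀ hb0.ne', one_smul]
  have hneg : ∀ y, -F y ∈ Set.range F := fun y => by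
    obtain ⟨φ, hφ⟩ := H y (1 / 2) (by norm_num) (by norm_num)
    refine ⟨φ⁻¹ o, ?_⟩
    have := haff y (1 / 2) φ (by norm_num) (by norm_num) hφ (φ⁻¹ o)
    rw [perm_apply_inv, hF0] at this
    have h2 : F y + F (φ⁻¹ o) = (2 : ℝ) • ((1 - 1 / 2 : ℝ) • F y + (1 / 2 : ℝ) • F (φ⁻¹ o)) := by
      module
    rw [← this, smul_zero] at h2
    exact (neg_eq_of_add_eq_zero_right h2).symm
  have hsmul : ∀ (b : ℝ) y, b • F y ∈ Set.range F := fun b y => by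
    have hpos : ∀ b : ℝ, 0 < b → ∀ y, b • F y ∈ Set.range F := fun b hb y => by
      rcases lt_trichotomy b 1 with h | h | h
      · exact hsmul_lt b hb h y
      · exact ⟨y, by rw [h, one_smul]⟩
      · exact hsmul_gt b h y
    rcases lt_trichotomy b 0 with h | h | h
    · obtain ⟨w, hw⟩ := hpos (-b) (by linarith) y
      obtain ⟨v, hv⟩ := hneg w
      exact ⟨v, by rw [hv, hw]; module⟩
    · exact ⟨o, by rw [h, zero_smul, hF0]⟩
    · exact hpos b h y
  let S : Submodule ℝ (lp (fun _ : 𝒜 => ℝ) ∞) :=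
    { carrier := Set.range F
      zero_mem' := ⟨o, hF0⟩
      add_mem' := by
        rintro _ _ ⟨y, rfl⟩ ⟨z, rfl⟩
        obtain ⟨φ, hφ⟩ := H y (1 / 2) (by norm_num) (by norm_num)
        obtain ⟨w, hw⟩ := hsmul 2 (φ z)
        refine ⟨w, ?_⟩
        rw [hw, haff y (1 / 2) φ (by norm_num) (by norm_num) hφ]
        module
      smul_mem' := by
        rintro b _ ⟨y, rfl⟩
        exact hsmul b y }
  let e : T ≃ S := Equiv.ofBijective (fun y => ⟨F y, y, rfl⟩)
    ⟨fun y z h => hiso.injective (congrArg Subtype.val h), by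
      rintro ⟨_, y, rfl⟩
      exact ⟨y, rfl⟩⟩
  exact ⟨S, inferInstance, inferInstance, ⟨e, fun y z => hiso y z⟩, Subtype.ext hF0⟩

end Dilation

end BusemannMCP

/-! ### Tangent spaces as ultralimits -/

namespace BusemannMCP

theorem half_pow_pos (k : ℕ) : (0 : ℝ) < (1 / 2) ^ k := by positivity

theorem half_pow_le_one (k : ℕ) : (1 / 2 : ℝ) ^ k ≤ 1 := pow_le_one₀ (by norm_num) (by norm_num)

theorem tendsto_half_pow : Tendsto (fun k : ℕ => (1 / 2 : ℝ) ^ k) atTop (nhds 0) :=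
  tendsto_pow_atTop_nhds_zero_of_lt_one (by norm_num) (by norm_num)

theorem exists_seq_of_eventually {α : Type*} [Nonempty α] {P : ℕ → α → Prop} {f : ℕ → α → ℝ}
    (hf : ∀ k z, 0 ≤ f k z)
    (h : ∀ ε > 0, ∀ᶠ k in atTop, ∃ z, P k z ∧ f k z ≤ ε) :
    ∃ z : ℕ → α, (∀ᶠ k in atTop, P k (z k)) ∧ ∀ ε > 0, ∀ᶠ k in atTop, f k (z k) ≤ ε := by
  have key : ∀ k : ℕ, ∃ z, (∃ z, P k z) →
      P k z ∧ ∀ z', P k z' → f k z ≤ f k z' + 1 / ((k : ℝ) + 1) := fun k => by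
    by_cases hk : ∃ z, P k z
    · obtain ⟨z₀, hz₀⟩ := hk
      obtain ⟨_, ⟨z, hz, rfl⟩, hlt⟩ := Real.lt_sInf_add_pos
        (show (f k '' {z | P k z}).Nonempty from ⟨_, z₀, hz₀, rfl⟩)
        (show (0 : ℝ) < 1 / ((k : ℝ) + 1) by positivity)
      refine ⟨z, fun _ => ⟨hz, fun z' hz' => hlt.le.trans ?_⟩⟩
      have hbdd : BddBelow (f k '' {z | P k z}) :=
        ⟨0, by rintro _ ⟨w, -, rfl⟩; exact hf k w⟩
      have := csInf_le hbdd ⟨z', hz', rfl⟩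
      linarith
    · exact ⟨Classical.arbitrary α, fun h => absurd h hk⟩
  choose z hz using key
  refine ⟨z, ?_, fun ε hε => ?_⟩
  · filter_upwards [h 1 one_pos] with k hk
    exact (hz k (hk.imp fun _ h => h.1)).1
  · filter_upwards [h (ε / 2) (half_pos hε),
      (tendsto_one_div_add_atTop_nhds_zero_nat (𝕜 := ℝ)).eventually_le_const (half_pos hε)]
      with k hk hk'
    obtain ⟨z', h1, h2⟩ := hk
    have := (hz k ⟨z', h1⟩).2 z' h1
    linarith

/-- Sequences converging to `x` at least linearly with respect to the scale `(1 / 2) ^ k`. -/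
def TangentSeq {X : Type*} [MetricSpace X] (x : X) : Type _ :=
  {y : ℕ → X // ∃ C : ℝ, ∀ k, dist x (y k) ≤ C * (1 / 2) ^ k}

section Tangent

variable {X : Type*} [MetricSpace X] {x : X}

instance : CoeFun (TangentSeq x) fun _ => ℕ → X := ⟨fun y => y.1⟩

theorem TangentSeq.exists_bound (y : TangentSeq x) :
    ∃ C : ℝ, 0 < C ∧ ∀ k, dist x (y k) < C * (1 / 2) ^ k := by
  obtain ⟨C, hC⟩ := y.2
  refine ⟨|C| + 1, by positivity, fun k => (hC k).trans_lt ?_⟩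
  have := half_pow_pos k
  nlinarith [le_abs_self C]

theorem TangentSeq.tendsto (y : TangentSeq x) : Tendsto y atTop (nhds x) := by
  obtain ⟨C, -, hC⟩ := y.exists_bound
  rw [tendsto_iff_dist_tendsto_zero]
  refine squeeze_zero (fun _ => dist_nonneg) (fun k => ?_)
    (by have := tendsto_half_pow.const_mul C; rwa [mul_zero] at this)
  rw [dist_comm]
  exact (hC k).le

theorem TangentSeq.eventually_mem_ball (y : TangentSeq x) {r : ℝ} (hr : 0 < r) :
    ∀ᶠ k in (hyperfilter ℕ : Filter ℕ), y k ∈ ball x r :=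
  Nat.hyperfilter_le_atTop (y.tendsto.eventually (ball_mem_nhds x hr))

noncomputable instance : Dist (TangentSeq x) :=
  ⟨fun y z => limUnder (hyperfilter ℕ : Filter ℕ) fun k => dist (y k) (z k) / (1 / 2) ^ k⟩

theorem TangentSeq.tendsto_dist (y z : TangentSeq x) :
    Tendsto (fun k => dist (y k) (z k) / (1 / 2) ^ k) (hyperfilter ℕ : Filter ℕ)
      (nhds (dist y z)) := by
  obtain ⟨C, hC0, hC⟩ := y.exists_bound
  obtain ⟨D, hD0, hD⟩ := z.exists_bound
  have hmem : ∀ k, dist (y k) (z k) / (1 / 2) ^ k ∈ Set.Icc (0 : ℝ) (C + D) := fun k => by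
    have := half_pow_pos k
    refine ⟨by positivity, ?_⟩
    rw [div_le_iff₀ this]
    have h1 := dist_triangle_left (y k) (z k) x
    linarith [hC k, hD k]
  obtain ⟨a, -, ha⟩ := (isCompact_Icc (a := (0 : ℝ)) (b := C + D)).ultrafilter_le_nhds
    ((hyperfilter ℕ).map fun k => dist (y k) (z k) / (1 / 2) ^ k)
    (le_principal_iff.2 (Filter.mem_map.2 (Filter.univ_mem' hmem)))
  have ha' : Tendsto (fun k => dist (y k) (z k) / (1 / 2) ^ k) (hyperfilter ℕ : Filter ℕ)
    (nhds a) := ha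
  have h : dist y z = a := ha'.limUnder_eq
  rw [h]
  exact ha'

noncomputable instance : PseudoMetricSpace (TangentSeq x) where
  dist_self y := tendsto_nhds_unique (y.tendsto_dist y) (by simp)
  dist_comm y z := tendsto_nhds_unique (y.tendsto_dist z)
    ((z.tendsto_dist y).congr fun k => by rw [dist_comm])
  dist_triangle y z w := le_of_tendsto_of_tendsto' (y.tendsto_dist w)
    ((y.tendsto_dist z).add (z.tendsto_dist w)) fun k => by
      rw [← add_div]
      have := half_pow_pos k
      gcongr
      exact dist_triangle _ _ _

/-- The constant sequence at the base point. -/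
def TangentSeq.base (x : X) : TangentSeq x := ⟨fun _ => x, 0, by simp⟩

variable {r₀ : ℝ} (L : LocalGeodesicStructure X (ball x r₀))

theorem LocalGeodesicStructure.dist_left {U : Set X} (L : LocalGeodesicStructure X U) {c y : X}
    (hc : c ∈ U) (hy : y ∈ U) {a : ℝ} (ha : a ∈ Set.Icc (0 : ℝ) 1) :
    dist c (L.σ c y a) = a * dist c y := by
  have := L.dist_σ c hc y hy 0 (by simp) a ha
  rwa [L.σ_zero c hc y hy, zero_sub, abs_neg, abs_of_nonneg ha.1] at this

theorem LocalGeodesicStructure.dist_right {U : Set X} (L : LocalGeodesicStructure X U) {c y : X}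
    (hc : c ∈ U) (hy : y ∈ U) {a : ℝ} (ha : a ∈ Set.Icc (0 : ℝ) 1) :
    dist y (L.σ c y a) = (1 - a) * dist c y := by
  have := L.dist_σ c hc y hy 1 (by simp) a ha
  rwa [L.σ_one c hc y hy, abs_of_nonneg (sub_nonneg.2 ha.2)] at this

theorem exists_tangentSeq_dilation (hr₀ : 0 < r₀) (c : TangentSeq x) {a : ℝ}
    (ha : a ∈ Set.Icc (0 : ℝ) 1) :
    ∃ φ : TangentSeq x → TangentSeq x,
      ∀ y, ∀ᶠ k in (hyperfilter ℕ : Filter ℕ), φ y k = L.σ (c k) (y k) a := by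
  classical
  refine ⟨fun y => ⟨fun k => if c k ∈ ball x r₀ ∧ y k ∈ ball x r₀ then L.σ (c k) (y k) a else x,
    ?_⟩, fun y => ?_⟩
  · obtain ⟨C, hC0, hC⟩ := c.exists_bound
    obtain ⟨D, hD0, hD⟩ := y.exists_bound
    refine ⟨2 * C + D, fun k => ?_⟩
    have hk := half_pow_pos k
    beta_reduce
    split_ifs with h
    · have h1 := dist_triangle x (c k) (L.σ (c k) (y k) a)
      rw [LocalGeodesicStructure.dist_left L h.1 h.2 ha] at h1
      have h2 := dist_triangle_left (c k) (y k) x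
      have h3 : a * dist (c k) (y k) ≤ 1 * dist (c k) (y k) :=
        mul_le_mul_of_nonneg_right ha.2 dist_nonneg
      linarith [hC k, hD k]
    · rw [dist_self]; positivity
  · filter_upwards [c.eventually_mem_ball hr₀, y.eventually_mem_ball hr₀] with k h1 h2
    exact if_pos ⟨h1, h2⟩

/-- Contractions towards arbitrary points become dilations at infinitesimal scales. -/
structure AsymptoticDilations : Prop where
  convex : ∀ p ∈ ball x r₀, ∀ y ∈ ball x r₀, ∀ z ∈ ball x r₀, ∀ t ∈ Set.Icc (0 : ℝ) 1,
    dist (L.σ p y t) (L.σ p z t) ≤ t * dist y z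
  expanding : ∀ a : ℝ, 0 < a → a < 1 → ∀ ε > 0, ∃ r₁ > 0, ∀ r, 0 < r → r < r₁ →
    ∀ c ∈ ball x r, ∀ y ∈ ball x r, ∀ z ∈ ball x r,
      a * dist y z - ε * r ≤ dist (L.σ c y a) (L.σ c z a)
  surjective : ∀ a : ℝ, 0 < a → a < 1 → ∀ ε > 0, ∃ r₁ > 0, ∀ r, 0 < r → r < r₁ →
    ∀ c ∈ ball x r, ∀ y ∈ ball x r, ∃ z ∈ ball x (4 * r / a), dist (L.σ c z a) y ≤ ε * r

variable {L}

theorem AsymptoticDilations.dist_map (hL : AsymptoticDilations L) (hr₀ : 0 < r₀)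
    {c : TangentSeq x} {a : ℝ} (ha : 0 < a) (ha1 : a < 1) {φ : TangentSeq x → TangentSeq x}
    (hφ : ∀ y, ∀ᶠ k in (hyperfilter ℕ : Filter ℕ), φ y k = L.σ (c k) (y k) a)
    (y z : TangentSeq x) : dist (φ y) (φ z) = a * dist y z := by
  refine le_antisymm ?_ ?_
  · refine le_of_tendsto_of_tendsto ((φ y).tendsto_dist (φ z))
      ((y.tendsto_dist z).const_mul a) ?_
    filter_upwards [hφ y, hφ z, c.eventually_mem_ball hr₀, y.eventually_mem_ball hr₀,
      z.eventually_mem_ball hr₀] with k h1 h2 h3 h4 h5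
    rw [h1, h2, ← mul_div_assoc]
    have := half_pow_pos k
    gcongr
    exact hL.convex _ h3 _ h4 _ h5 a ⟨ha.le, ha1.le⟩
  · obtain ⟨C1, hC10, hC1⟩ := c.exists_bound
    obtain ⟨C2, hC20, hC2⟩ := y.exists_bound
    obtain ⟨C3, hC30, hC3⟩ := z.exists_bound
    set C := C1 + C2 + C3 with hC
    have hC0 : 0 < C := by positivity
    refine le_of_forall_pos_le_add fun ε hε => ?_
    obtain ⟨r₁, hr₁, H⟩ := hL.expanding a ha ha1 (ε / C) (by positivity)
    have hsmall : ∀ᶠ k in (hyperfilter ℕ : Filter ℕ), C * (1 / 2 : ℝ) ^ k < r₁ :=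
      Nat.hyperfilter_le_atTop
        ((tendsto_half_pow.const_mul C).eventually_lt_const (by simpa using hr₁))
    refine le_of_tendsto_of_tendsto ((y.tendsto_dist z).const_mul a)
      (((φ y).tendsto_dist (φ z)).add_const ε) ?_
    filter_upwards [hφ y, hφ z, hsmall] with k h1 h2 h3
    have hk := half_pow_pos k
    have h4 := H (C * (1 / 2) ^ k) (by positivity) h3 (c k)
      (by rw [mem_ball']; nlinarith [hC1 k]) (y k) (by rw [mem_ball']; nlinarith [hC2 k])
      (z k) (by rw [mem_ball']; nlinarith [hC3 k])
    rw [← h1, ← h2] at h4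
    have h5 : ε / C * (C * (1 / 2 : ℝ) ^ k) = ε * (1 / 2) ^ k := by field_simp
    rw [h5] at h4
    rw [← mul_div_assoc, div_add' _ _ _ hk.ne']
    gcongr
    linarith

theorem AsymptoticDilations.exists_preimage (hL : AsymptoticDilations L)
    {c : TangentSeq x} {a : ℝ} (ha : 0 < a) (ha1 : a < 1) {φ : TangentSeq x → TangentSeq x}
    (hφ : ∀ y, ∀ᶠ k in (hyperfilter ℕ : Filter ℕ), φ y k = L.σ (c k) (y k) a)
    (y : TangentSeq x) : ∃ z, dist (φ z) y = 0 := by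
  classical
  obtain ⟨C1, hC10, hC1⟩ := c.exists_bound
  obtain ⟨C2, hC20, hC2⟩ := y.exists_bound
  set C := C1 + C2 with hC
  have hC0 : 0 < C := by positivity
  have : Nonempty X := ⟨x⟩
  obtain ⟨z, hz1, hz2⟩ := exists_seq_of_eventually
    (P := fun k z => z ∈ ball x (4 * (C * (1 / 2 : ℝ) ^ k) / a))
    (f := fun k z => dist (L.σ (c k) z a) (y k) / (1 / 2) ^ k) (fun k z => by positivity)
    (fun ε hε => by
      obtain ⟨r₁, hr₁, H⟩ := hL.surjective a ha ha1 (ε / C) (by positivity)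
      filter_upwards [(tendsto_half_pow.const_mul C).eventually_lt_const
        (show C * 0 < r₁ by simpa using hr₁)] with k h3
      have hk := half_pow_pos k
      obtain ⟨z, hz, hz'⟩ := H (C * (1 / 2) ^ k) (by positivity) h3 (c k)
        (by rw [mem_ball']; nlinarith [hC1 k]) (y k) (by rw [mem_ball']; nlinarith [hC2 k])
      refine ⟨z, hz, ?_⟩
      rw [div_le_iff₀ hk]
      refine hz'.trans_eq ?_
      field_simp)
  let z' : TangentSeq x := ⟨fun k => if z k ∈ ball x (4 * (C * (1 / 2 : ℝ) ^ k) / a) then z k else x,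
    4 * C / a, fun k => by
      have hk := half_pow_pos k
      beta_reduce
      split_ifs with h
      · rw [mem_ball'] at h
        refine h.le.trans_eq ?_
        ring
      · rw [dist_self]; positivity⟩
  refine ⟨z', le_antisymm (le_of_forall_pos_le_add fun ε hε => ?_) dist_nonneg⟩
  rw [zero_add]
  refine le_of_tendsto ((φ z').tendsto_dist y) ?_
  filter_upwards [hφ z', Nat.hyperfilter_le_atTop hz1, Nat.hyperfilter_le_atTop (hz2 ε hε)]
    with k h1 h2 h3
  have h4 : z' k = z k := if_pos h2
  rw [h1, h4]
  exact h3

theorem AsymptoticDilations.exists_isRadialDilation (hL : AsymptoticDilations L) (hr₀ : 0 < r₀)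
    (c : SeparationQuotient (TangentSeq x)) (a : ℝ) (ha : 0 < a) (ha1 : a < 1) :
    ∃ ψ, IsRadialDilation c a ψ := by
  obtain ⟨c, rfl⟩ := SeparationQuotient.surjective_mk c
  obtain ⟨φ, hφ⟩ := exists_tangentSeq_dilation L hr₀ c (a := a) ⟨ha.le, ha1.le⟩
  have hdist := hL.dist_map hr₀ ha ha1 hφ
  have hself : ∀ y, dist y (φ y) = (1 - a) * dist c y := fun y => by
    refine tendsto_nhds_unique (y.tendsto_dist (φ y)) (((c.tendsto_dist y).const_mul _).congr' ?_)
    filter_upwards [hφ y, c.eventually_mem_ball hr₀, y.eventually_mem_ball hr₀] with k h1 h2 h3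
    rw [h1, LocalGeodesicStructure.dist_right L h2 h3 ⟨ha.le, ha1.le⟩, mul_div_assoc]
  let ψ₀ : SeparationQuotient (TangentSeq x) → SeparationQuotient (TangentSeq x) :=
    SeparationQuotient.lift (fun y => SeparationQuotient.mk (φ y)) fun y z h => by
      rw [SeparationQuotient.mk_eq_mk, Metric.inseparable_iff, hdist, Metric.inseparable_iff.1 h,
        mul_zero]
  have hψ₀ : ∀ y, ψ₀ (SeparationQuotient.mk y) = SeparationQuotient.mk (φ y) := fun y => rfl
  have hdist' : ∀ y z, dist (ψ₀ y) (ψ₀ z) = a * dist y z := fun y z => by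
    obtain ⟨y, rfl⟩ := SeparationQuotient.surjective_mk y
    obtain ⟨z, rfl⟩ := SeparationQuotient.surjective_mk z
    rw [hψ₀, hψ₀, SeparationQuotient.dist_mk, SeparationQuotient.dist_mk, hdist]
  have hself' : ∀ y, dist y (ψ₀ y) = (1 - a) * dist (SeparationQuotient.mk c) y := fun y => by
    obtain ⟨y, rfl⟩ := SeparationQuotient.surjective_mk y
    rw [hψ₀, SeparationQuotient.dist_mk, SeparationQuotient.dist_mk, hself]
  refine ⟨Equiv.ofBijective ψ₀ ⟨fun y z h => ?_, fun y => ?_⟩, hdist', ?_, hself'⟩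
  · have := hdist' y z
    rw [h, dist_self, eq_comm, mul_eq_zero] at this
    exact dist_eq_zero.1 (this.resolve_left ha.ne')
  · obtain ⟨y, rfl⟩ := SeparationQuotient.surjective_mk y
    obtain ⟨z, hz⟩ := hL.exists_preimage ha ha1 hφ y
    refine ⟨SeparationQuotient.mk z, ?_⟩
    rw [hψ₀, SeparationQuotient.mk_eq_mk, Metric.inseparable_iff, hz]
  · have := hself' (SeparationQuotient.mk c)
    rw [dist_self, mul_zero] at this
    exact (dist_eq_zero.1 this).symm

variable (L) in
/-- The direction of the geodesic from `x` to a nearby point, scaled by the distance. -/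
theorem exists_log (hr₀ : 0 < r₀) : ∃ f : X → TangentSeq x,
    ∀ y ∈ ball x r₀, ∀ k, f y k = L.σ x y ((1 / 2) ^ k) := by
  classical
  refine ⟨fun y => ⟨fun k => if y ∈ ball x r₀ then L.σ x y ((1 / 2) ^ k) else x, dist x y,
    fun k => ?_⟩, fun y hy k => if_pos hy⟩
  have hk := half_pow_pos k
  beta_reduce
  split_ifs with h
  · rw [LocalGeodesicStructure.dist_left L (mem_ball_self hr₀) h ⟨hk.le, half_pow_le_one k⟩,
      mul_comm]
  · rw [dist_self]; positivity

theorem tendsto_half_pow_nhdsGT :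
    Tendsto (fun k : ℕ => (1 / 2 : ℝ) ^ k) (hyperfilter ℕ : Filter ℕ) (nhdsWithin 0 (Set.Ioi 0)) :=
  tendsto_nhdsWithin_iff.2 ⟨tendsto_half_pow.mono_left Nat.hyperfilter_le_atTop,
    .of_forall half_pow_pos⟩

/-- The logarithm at a point with asymptotic dilations is a bi-Lipschitz chart in a normed
space. -/
theorem AsymptoticDilations.exists_chart {X : Type u} [MetricSpace X] [ProperSpace X] {x : X}
    {r₀ : ℝ} {L : LocalGeodesicStructure X (ball x r₀)}
    (hL : AsymptoticDilations L) (hr₀ : 0 < r₀)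
    (hinj : ∃ C > 0, ∃ R > 0, ∀ y ∈ ball x R, ∀ z ∈ ball x R,
      ∀ᶠ t in nhdsWithin (0 : ℝ) (Set.Ioi 0), C * t * dist y z ≤ dist (L.σ x y t) (L.σ x z t))
    (hsurj : ∃ R > 0, ∀ w ∈ ball x R, ∀ s, 0 < s → s < R →
      ∀ᶠ t in nhdsWithin (0 : ℝ) (Set.Ioi 0), ∀ u, dist u (L.σ x w t) ≤ 5 / 8 * t * s →
        ∃ b ∈ ball w s, dist u (L.σ x b t) < t * s / 4) :
    ∃ (E : Type u) (_ : NormedAddCommGroup E) (_ : NormedSpace ℝ E) (C R : ℝ) (f : X → E),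
      0 < C ∧ 0 < R ∧ (∀ y ∈ ball x R, ‖f y‖ = dist x y) ∧
      (∀ y ∈ ball x R, ∀ z ∈ ball x R, dist (f y) (f z) ≤ dist y z ∧
        C * dist y z ≤ dist (f y) (f z)) ∧
      ∀ v ∈ ball (0 : E) R, ∃ y ∈ ball x R, f y = v := by
  obtain ⟨C, hC, R₁, hR₁, hinj⟩ := hinj
  obtain ⟨R₂, hR₂, hsurj⟩ := hsurj
  obtain ⟨f, hf⟩ := exists_log L hr₀
  have hx : x ∈ ball x r₀ := mem_ball_self hr₀
  obtain ⟨R, hR, hRr, hRR₁, hRR₂⟩ : ∃ R > 0, 4 * R < r₀ ∧ R < R₁ ∧ 2 * R < R₂ := by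
    refine ⟨min r₀ (min R₁ R₂) / 5, by positivity, ?_, ?_, ?_⟩ <;>
    nlinarith [min_le_left r₀ (min R₁ R₂), min_le_right r₀ (min R₁ R₂), min_le_left R₁ R₂,
      min_le_right R₁ R₂, lt_min hr₀ (lt_min hR₁ hR₂)]
  let g : X → SeparationQuotient (TangentSeq x) := fun y => SeparationQuotient.mk (f y)
  have hgf : ∀ y z, dist (g y) (g z) = dist (f y) (f z) := fun y z => SeparationQuotient.dist_mk _ _
  have hlip : ∀ y ∈ ball x r₀, ∀ z ∈ ball x r₀, dist (g y) (g z) ≤ dist y z := fun y hy z hz => by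
    rw [hgf]
    refine le_of_tendsto ((f y).tendsto_dist (f z)) (.of_forall fun k => ?_)
    have hk := half_pow_pos k
    rw [hf y hy, hf z hz, div_le_iff₀ hk, mul_comm]
    exact hL.convex x hx y hy z hz _ ⟨hk.le, half_pow_le_one k⟩
  have hrad : ∀ y ∈ ball x r₀, dist (g x) (g y) = dist x y := fun y hy => by
    rw [hgf]
    refine tendsto_nhds_unique ((f x).tendsto_dist (f y)) ?_
    refine tendsto_const_nhds.congr fun k => ?_
    have hk := half_pow_pos k
    have h1 := LocalGeodesicStructure.dist_left L hx hx ⟨hk.le, half_pow_le_one k⟩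
    rw [dist_self, mul_zero] at h1
    rw [hf x hx, hf y hy, ← dist_eq_zero.1 h1,
      LocalGeodesicStructure.dist_left L hx hy ⟨hk.le, half_pow_le_one k⟩]
    field_simp
  have hanti : ∀ y ∈ ball x R, ∀ z ∈ ball x R, C * dist y z ≤ dist (g y) (g z) := by
    intro y hy z hz
    rw [hgf]
    have hsub : ∀ w ∈ ball x R, w ∈ ball x R₁ ∧ w ∈ ball x r₀ := fun w hw =>
      ⟨ball_subset_ball hRR₁.le hw, ball_subset_ball (by linarith) hw⟩
    refine ge_of_tendsto ((f y).tendsto_dist (f z)) ?_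
    filter_upwards [tendsto_half_pow_nhdsGT.eventually (hinj y (hsub y hy).1 z (hsub z hz).1)]
      with k h
    have hk := half_pow_pos k
    rw [hf y (hsub y hy).2, hf z (hsub z hz).2, le_div_iff₀ hk]
    linarith
  have hcont : ContinuousOn g (closedBall x (4 * R)) := by
    refine (LipschitzOnWith.of_dist_le_mul (K := 1) fun y hy z hz => ?_).continuousOn
    rw [NNReal.coe_one, one_mul]
    exact hlip y (closedBall_subset_ball hRr hy) z (closedBall_subset_ball hRr hz)
  have hrange : ∀ v, dist (g x) v < R → ∃ y ∈ ball x R, g y = v := by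
    intro v hv
    obtain ⟨w, hw, hmin⟩ := (isCompact_closedBall x (4 * R)).exists_isMinOn
      (f := fun y => dist v (g y)) ⟨x, mem_closedBall_self (by linarith)⟩
      ((continuous_const.dist continuous_id).comp_continuousOn hcont)
    have hmin' : ∀ b ∈ closedBall x (4 * R), dist v (g w) ≤ dist v (g b) := hmin
    rcases eq_or_ne v (g w) with hvw | hvw
    · refine ⟨w, ?_, hvw.symm⟩
      rwa [hvw, hrad w (closedBall_subset_ball hRr hw), ← mem_ball'] at hv
    exfalso
    set η := dist v (g w) with hη
    have hη0 : 0 < η := dist_pos.2 hvw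
    have hηR : η < R := (hmin' x (mem_closedBall_self (by linarith))).trans_lt (by rwa [dist_comm])
    have hwr₀ := closedBall_subset_ball hRr hw
    have hwR : dist x w < 2 * R := by
      rw [← hrad w hwr₀]
      linarith [dist_triangle (g x) v (g w)]
    obtain ⟨ψ, hψ⟩ := hL.exists_isRadialDilation hr₀ (g w) (1 / 2) (by norm_num) (by norm_num)
    obtain ⟨u, hu⟩ := SeparationQuotient.surjective_mk (ψ v)
    have hvu : dist v (SeparationQuotient.mk u) = η / 2 := by
      rw [hu, hψ.dist_self, dist_comm]; ring
    have huw : dist u (f w) = η / 2 := by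
      rw [← SeparationQuotient.dist_mk, hu]
      change dist (ψ v) (g w) = _
      have := hψ.dist_map v (g w)
      rw [hψ.map_center] at this
      rw [this]; ring
    have hev : ∀ᶠ k in (hyperfilter ℕ : Filter ℕ), ∃ b ∈ ball w η,
        dist (u k) (L.σ x b ((1 / 2) ^ k)) < (1 / 2) ^ k * η / 4 := by
      filter_upwards [tendsto_half_pow_nhdsGT.eventually
        (hsurj w (mem_ball'.2 (hwR.trans hRR₂)) η hη0 (by linarith)),
        (u.tendsto_dist (f w)).eventually_le_const
          (show dist u (f w) < 5 / 8 * η by rw [huw]; linarith)] with k h1 h2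
      refine h1 _ ?_
      have hk := half_pow_pos k
      rw [div_le_iff₀ hk, hf w hwr₀] at h2
      linarith
    have hchoice : ∀ k : ℕ, ∃ b : X, b ∈ closedBall x (4 * R) ∧
        ((∃ b ∈ ball w η, dist (u k) (L.σ x b ((1 / 2) ^ k)) < (1 / 2) ^ k * η / 4) →
          dist (u k) (L.σ x b ((1 / 2) ^ k)) < (1 / 2) ^ k * η / 4) := fun k => by
      by_cases hk : ∃ b ∈ ball w η, dist (u k) (L.σ x b ((1 / 2) ^ k)) < (1 / 2) ^ k * η / 4
      · obtain ⟨b, hb, hb'⟩ := hk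
        refine ⟨b, ?_, fun _ => hb'⟩
        rw [mem_closedBall']
        rw [mem_ball'] at hb
        linarith [dist_triangle x w b]
      · exact ⟨x, mem_closedBall_self (by linarith), fun h => absurd h hk⟩
    choose b hb using hchoice
    obtain ⟨b', hb', hlim⟩ := (isCompact_closedBall x (4 * R)).ultrafilter_le_nhds
      ((hyperfilter ℕ).map b) (le_principal_iff.2 (Filter.mem_map.2 (Filter.univ_mem' fun k => (hb k).1)))
    have hlim' : Tendsto b (hyperfilter ℕ : Filter ℕ) (nhds b') := hlim
    have hub : dist u (f b') ≤ η / 4 := by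
      have h0 : Tendsto (fun k => η / 4 + dist (b k) b') (hyperfilter ℕ : Filter ℕ)
          (nhds (η / 4 + 0)) :=
        (tendsto_iff_dist_tendsto_zero.1 hlim').const_add _
      rw [add_zero] at h0
      refine le_of_tendsto_of_tendsto (u.tendsto_dist (f b')) h0 ?_
      filter_upwards [hev] with k h1
      have hk := half_pow_pos k
      have h2 := (hb k).2 h1
      have h3 := hL.convex x hx (b k) (closedBall_subset_ball hRr (hb k).1) b'
        (closedBall_subset_ball hRr hb') _ ⟨hk.le, half_pow_le_one k⟩
      rw [div_le_iff₀ hk, hf b' (closedBall_subset_ball hRr hb')]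
      linarith [dist_triangle (u k) (L.σ x (b k) ((1 / 2) ^ k)) (L.σ x b' ((1 / 2) ^ k))]
    have h1 := hmin' b' hb'
    have h2 := dist_triangle v (SeparationQuotient.mk u) (g b')
    have h3 : dist (SeparationQuotient.mk u) (g b') = dist u (f b') :=
      SeparationQuotient.dist_mk _ _
    linarith
  obtain ⟨E, hE1, hE2, Φ, hΦ⟩ := exists_isometryEquiv_normedSpace (g x)
    (hL.exists_isRadialDilation hr₀)
  refine ⟨E, hE1, hE2, C, R, fun y => Φ (g y), hC, hR, fun y hy => ?_, fun y hy z hz => ?_,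
    fun v hv => ?_⟩
  · rw [← dist_zero_left, ← hΦ, Φ.dist_eq, hrad y (ball_subset_ball (by linarith) hy)]
  · rw [Φ.dist_eq]
    exact ⟨hlip y (ball_subset_ball (by linarith) hy) z (ball_subset_ball (by linarith) hz),
      hanti y hy z hz⟩
  · obtain ⟨y, hy, hy'⟩ := hrange (Φ.symm v) (by
      rw [← Φ.dist_eq, hΦ, Φ.apply_symm_apply, dist_comm]
      exact hv)
    exact ⟨y, hy, by simp only [hy', Φ.apply_symm_apply]⟩

end Tangent

end BusemannMCP

/-! ### Volume comparison -/

namespace BusemannMCP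

theorem exists_mul_rpow_le_mcpCoeff {K n : ℝ} (hn : 1 ≤ n) (hK : K ≤ 0) {ε : ℝ} (hε : 0 < ε) :
    ∃ R > 0, ∀ d, 0 < d → d < R → ∀ t ∈ Set.Icc (0 : ℝ) 1, (1 - ε) * t ^ n ≤ mcpCoeff K n t d := by
  by_cases h : K = 0 ∨ n = 1
  · refine ⟨1, one_pos, fun d _ _ t ht => ?_⟩
    rw [mcpCoeff, if_pos h]
    nlinarith [Real.rpow_nonneg ht.1 n]
  · have hKn := h
    push Not at h
    have hn1 : 0 < n - 1 := sub_pos.2 (lt_of_le_of_ne hn h.2.symm)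
    have hκ : 0 < Real.sqrt (-K / (n - 1)) :=
      Real.sqrt_pos.2 (div_pos (neg_pos.2 (lt_of_le_of_ne hK h.1)) hn1)
    set κ := Real.sqrt (-K / (n - 1)) with hκdef
    have hlim : Tendsto (fun u : ℝ => (u / Real.sinh u) ^ (n - 1)) (nhdsWithin 0 (Set.Ioi 0))
        (nhds 1) := by
      have h1 := (hasDerivAt_iff_tendsto_slope_zero.1 (Real.hasDerivAt_sinh 0)).mono_left
        (nhdsWithin_mono 0 fun u (hu : 0 < u) => hu.ne')
      simp only [zero_add, Real.sinh_zero, sub_zero, Real.cosh_zero, smul_eq_mul] at h1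
      have h2 := (h1.inv₀ one_ne_zero).rpow_const (p := n - 1) (Or.inr hn1.le)
      rw [inv_one, Real.one_rpow] at h2
      refine h2.congr fun u => ?_
      rw [mul_inv, inv_inv, div_eq_mul_inv]
    obtain ⟨R, hR, H⟩ := mem_nhdsGT_iff_exists_Ioo_subset.1
      (hlim.eventually_const_le (sub_lt_self 1 hε))
    refine ⟨R / κ, div_pos hR hκ, fun d hd hdR t ht => ?_⟩
    have hu : 0 < d * κ := mul_pos hd hκ
    have hs : 0 < Real.sinh (d * κ) := Real.sinh_pos_iff.2 hu
    have h1 : 1 - ε ≤ (d * κ / Real.sinh (d * κ)) ^ (n - 1) := H ⟨hu, (lt_div_iff₀ hκ).1 hdR⟩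
    rw [mcpCoeff, if_neg hKn, ← hκdef]
    have h2 : t * (d * κ / Real.sinh (d * κ)) ≤
        Real.sinh (t * d * κ) / Real.sinh (d * κ) := by
      rw [← mul_div_assoc]
      gcongr
      rw [← mul_assoc]
      exact Real.self_le_sinh_iff.2 (mul_nonneg (mul_nonneg ht.1 hd.le) hκ.le)
    have h3 : t ^ n = t * t ^ (n - 1) := by
      rcases eq_or_lt_of_le ht.1 with rfl | ht0
      · rw [Real.zero_rpow (by linarith), zero_mul]
      · rw [← Real.rpow_one_add' ht.1 (by linarith), add_sub_cancel]
    have h0 : 0 ≤ t * (d * κ / Real.sinh (d * κ)) := mul_nonneg ht.1 (by positivity)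
    calc (1 - ε) * t ^ n = t * (t ^ (n - 1) * (1 - ε)) := by rw [h3]; ring
      _ ≤ t * (t ^ (n - 1) * (d * κ / Real.sinh (d * κ)) ^ (n - 1)) := by
        have := ht.1
        have := Real.rpow_nonneg ht.1 (n - 1)
        gcongr
      _ = t * (t * (d * κ / Real.sinh (d * κ))) ^ (n - 1) := by
        rw [Real.mul_rpow ht.1 (by positivity)]
      _ ≤ _ := by
        have := ht.1
        gcongr

section

variable {X : Type*} [MetricSpace X] [MeasurableSpace X]

/-- The asymptotic Bishop–Gromov inequality at `x`. -/
def AsymptoticBishopGromov (m : Measure X) (n : ℝ) (x : X) : Prop :=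
  ∀ ε > 0, ∃ R > 0, ∀ p ∈ ball x R, ∀ s ρ : ℝ, 0 < s → s ≤ ρ → ρ ≤ R →
    (1 - ε) * (s / ρ) ^ n * m.real (ball p ρ) ≤ m.real (ball p s)

/-- Contractions towards points near `x` decrease volumes asymptotically at most like Euclidean
dilations. -/
def VolumeContraction (m : Measure X) (n : ℝ) {x : X} {r₀ : ℝ}
    (L : LocalGeodesicStructure X (ball x r₀)) : Prop :=
  ∀ ε > 0, ∃ R > 0, ∀ p ∈ ball x R, ∀ A ⊆ ball x R, MeasurableSet A → ∀ t ∈ Set.Icc (0 : ℝ) 1,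
    (1 - ε) * t ^ n * m.real A ≤ m.real ((fun a => L.σ p a t) '' A)

variable [ProperSpace X] [BorelSpace X] {m : Measure X} [IsLocallyFiniteMeasure m]

theorem volumeContraction_of_mcp [NullSingletonClass m] {K n : ℝ} (hn : 1 ≤ n) (hK : K ≤ 0) {x : X} {r₀ : ℝ}
    (hr₀ : 0 < r₀) (L : LocalGeodesicStructure X (ball x r₀))
    (h : ∀ p ∈ ball x r₀, ∀ A : Set X, A ⊆ ball x r₀ → MeasurableSet A → ∀ t ∈ Set.Icc (0:ℝ) 1,
      (∫⁻ a in A, ENNReal.ofReal (mcpCoeff K n t (dist p a)) ∂m) ≤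
        m ((fun a => L.σ p a t) '' A)) :
    VolumeContraction m n L := by
  intro ε hε
  obtain ⟨R, hR, H⟩ := exists_mul_rpow_le_mcpCoeff hn hK hε
  have hR' : 0 < min r₀ (R / 2) := lt_min hr₀ (half_pos hR)
  refine ⟨_, hR', fun p hp A hA hAm t ht => ?_⟩
  have hp₀ := ball_subset_ball (min_le_left _ _) hp
  have hA₀ := hA.trans (ball_subset_ball (min_le_left _ _))
  have h1 : ENNReal.ofReal ((1 - ε) * t ^ n) * m A ≤ m ((fun a => L.σ p a t) '' A) := by
    refine le_trans ?_ (h p hp₀ A hA₀ hAm t ht)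
    rw [← setLIntegral_const]
    have hne : ∀ᵐ a ∂m.restrict A, a ≠ p := ae_restrict_of_ae (Measure.ae_ne m p)
    refine lintegral_mono_ae ?_
    filter_upwards [hne, ae_restrict_mem hAm] with a ha haA
    refine ENNReal.ofReal_le_ofReal (H _ (dist_pos.2 ha.symm) ?_ t ht)
    have h2 := mem_ball.1 (ball_subset_ball (min_le_right _ _) hp)
    have h3 := mem_ball'.1 (ball_subset_ball (min_le_right _ _) (hA haA))
    linarith [dist_triangle p x a]
  have hfin : m ((fun a => L.σ p a t) '' A) ≠ ∞ := by
    refine ((measure_mono ?_).trans_lt (measure_ball_lt_top (x := x) (r := r₀))).ne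
    rintro _ ⟨a, ha, rfl⟩
    exact L.σ_mem p hp₀ a (hA₀ ha) t ht
  rcases le_or_gt ((1 - ε) * t ^ n) 0 with h0 | h0
  · exact (mul_nonpos_of_nonpos_of_nonneg h0 measureReal_nonneg).trans measureReal_nonneg
  · have := ENNReal.toReal_mono hfin h1
    rwa [ENNReal.toReal_mul, ENNReal.toReal_ofReal h0.le] at this

theorem VolumeContraction.asymptoticBishopGromov {n : ℝ} {x : X} {r₀ : ℝ} (hr₀ : 0 < r₀)
    {L : LocalGeodesicStructure X (ball x r₀)} (h : VolumeContraction m n L) :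
    AsymptoticBishopGromov m n x := by
  intro ε hε
  obtain ⟨R, hR, H⟩ := h ε hε
  have hR' : 0 < min r₀ R / 2 := half_pos (lt_min hr₀ hR)
  refine ⟨_, hR', fun p hp s ρ hs hsρ hρ => ?_⟩
  have hρ0 := hs.trans_le hsρ
  have hsub : ball p ρ ⊆ ball x (min r₀ R) :=
    ball_subset_ball' (by rw [mem_ball] at hp; linarith)
  have hp' : p ∈ ball x (min r₀ R) := ball_subset_ball (by linarith) hp
  have ht : s / ρ ∈ Set.Icc (0 : ℝ) 1 := ⟨by positivity, (div_le_one hρ0).2 hsρ⟩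
  refine (H p (ball_subset_ball (min_le_right _ _) hp') (ball p ρ)
    (hsub.trans (ball_subset_ball (min_le_right _ _))) measurableSet_ball _ ht).trans
    (measureReal_mono ?_ measure_ball_lt_top.ne)
  rintro _ ⟨a, ha, rfl⟩
  rw [mem_ball', LocalGeodesicStructure.dist_left L (ball_subset_ball (min_le_left _ _) hp')
    (ball_subset_ball (min_le_left _ _) (hsub ha)) ht]
  rw [mem_ball'] at ha
  calc s / ρ * dist p a < s / ρ * ρ := by gcongr
    _ = s := by field_simp

/-- The points at which the `n`-dimensional lower density is at most `c`. -/
def lowDensity (m : Measure X) (n c : ℝ) : Set X :=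
  {y | ∃ᶠ r in nhdsWithin (0 : ℝ) (Set.Ioi 0), m.real (ball y r) ≤ c * r ^ n}

theorem lowDensity_mono {n c d : ℝ} (h : c ≤ d) : lowDensity m n c ⊆ lowDensity m n d := by
  intro y hy
  refine (hy.and_eventually self_mem_nhdsWithin).mono fun r hr => hr.1.trans ?_
  have : 0 < r := hr.2
  gcongr

theorem hausdorffMeasure_forall_notMem_lowDensity {n : ℝ} (hn : 0 < n)
    [IsLocallyFiniteMeasure (μH[n] : Measure X)] :
    μH[n] {x : X | ∀ c, x ∉ lowDensity μH[n] n c} = 0 := by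
  set Z := {x : X | ∀ c, x ∉ lowDensity μH[n] n c} with hZ
  rcases isEmpty_or_nonempty X with hX | ⟨⟨x₀⟩⟩
  · rw [Set.eq_empty_of_isEmpty Z, measure_empty]
  suffices h : ∀ N : ℕ, μH[n] (Z ∩ ball x₀ N) = 0 by
    have h1 : Z = ⋃ N : ℕ, Z ∩ ball x₀ N := by
      rw [← Set.inter_iUnion, iUnion_ball_nat, Set.inter_univ]
    rw [h1]
    exact measure_iUnion_null h
  intro N
  have hfam : ∀ k : ℕ, ∃ (u : Set X) (r : X → ℝ), u.Countable ∧
      (∀ y ∈ u, 0 < r y ∧ 10 * r y ≤ 1 / ((k : ℝ) + 1)) ∧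
      Z ∩ ball x₀ N ⊆ ⋃ y : u, closedBall (y : X) (5 * r y) ∧
      ∑' y : u, ENNReal.ofReal (r y) ^ n ≤
        ENNReal.ofReal (1 / ((k : ℝ) + 1)) * μH[n] (ball x₀ (N + 1)) := by
    intro k
    have hk : (0 : ℝ) < 1 / ((k : ℝ) + 1) := by positivity
    have hr : ∀ y : X, ∃ r : ℝ, y ∈ Z → 0 < r ∧ 10 * r ≤ 1 / ((k : ℝ) + 1) ∧
        ((k : ℝ) + 1) * r ^ n ≤ (μH[n] : Measure X).real (ball y r) := by
      intro y
      by_cases hy : y ∈ Z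
      · have h1 := not_frequently.1 (hy ((k : ℝ) + 1))
        have h2 : ∀ᶠ r in nhdsWithin (0 : ℝ) (Set.Ioi 0), r < 1 / ((k : ℝ) + 1) / 10 :=
          mem_nhdsWithin_of_mem_nhds (Iio_mem_nhds (by positivity))
        obtain ⟨r, hr1, hr2, hr3⟩ := (h1.and (h2.and self_mem_nhdsWithin)).exists
        exact ⟨r, fun _ => ⟨hr3, by linarith, (not_le.1 hr1).le⟩⟩
      · exact ⟨0, fun h => absurd h hy⟩
    choose r hr using hr
    obtain ⟨u, hu, hdisj, hcov⟩ := Vitali.exists_disjoint_subfamily_covering_enlargement_closedBall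
      (Z ∩ ball x₀ N) (fun y => y) r 1 (fun y hy => by
        have h1 := (hr y hy.1).2.1
        have h2 : 1 / ((k : ℝ) + 1) ≤ 1 := by
          rw [div_le_one (by positivity)]; linarith [(Nat.cast_nonneg k : (0 : ℝ) ≤ k)]
        linarith [(hr y hy.1).1]) 5 (by norm_num)
    have hdisj' : u.PairwiseDisjoint fun y => ball y (r y) :=
      hdisj.mono fun y => ball_subset_closedBall
    have hcount : u.Countable := hdisj'.countable_of_isOpen (fun y _ => isOpen_ball)
      fun y hy => ⟨y, mem_ball_self (hr y (hu hy).1).1⟩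
    refine ⟨u, r, hcount, fun y hy => ⟨(hr y (hu hy).1).1, (hr y (hu hy).1).2.1⟩, ?_, ?_⟩
    · intro y hy
      obtain ⟨b, hb, hyb⟩ := hcov y hy
      exact Set.mem_iUnion.2 ⟨⟨b, hb⟩, hyb (mem_closedBall_self (hr y hy.1).1.le)⟩
    · have : Countable u := hcount.to_subtype
      calc ∑' y : u, ENNReal.ofReal (r y) ^ n
          ≤ ∑' y : u, ENNReal.ofReal (1 / ((k : ℝ) + 1)) * μH[n] (ball (y : X) (r y)) := by
            refine ENNReal.tsum_le_tsum fun y => ?_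
            obtain ⟨h1, -, h2⟩ := hr y (hu y.2).1
            rw [ENNReal.ofReal_rpow_of_pos h1, ← ofReal_measureReal measure_ball_lt_top.ne,
              ← ENNReal.ofReal_mul hk.le]
            refine ENNReal.ofReal_le_ofReal ?_
            rw [one_div, inv_mul_eq_div, le_div_iff₀ (by positivity), mul_comm]
            exact h2
        _ = ENNReal.ofReal (1 / ((k : ℝ) + 1)) * μH[n] (⋃ y ∈ u, ball y (r y)) := by
            rw [ENNReal.tsum_mul_left, measure_biUnion hcount hdisj' fun _ _ => measurableSet_ball]
        _ ≤ _ := by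
            gcongr
            refine Set.iUnion₂_subset fun y hy => ball_subset_ball' ?_
            have h1 := (hr y (hu hy).1).2.1
            have h2 : 1 / ((k : ℝ) + 1) ≤ 1 := by
              rw [div_le_one (by positivity)]; linarith [(Nat.cast_nonneg k : (0 : ℝ) ≤ k)]
            have h3 := mem_ball.1 (hu hy).2
            linarith [(hr y (hu hy).1).1]
  choose u r hcount hr hcov hsum using hfam
  have : ∀ k, Countable (u k) := fun k => (hcount k).to_subtype
  have hlim : Tendsto (fun k : ℕ => ENNReal.ofReal (1 / ((k : ℝ) + 1))) atTop (nhds 0) := by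
    have := ENNReal.tendsto_ofReal (tendsto_one_div_add_atTop_nhds_zero_nat (𝕜 := ℝ))
    rwa [ENNReal.ofReal_zero] at this
  have hdiam : ∀ k (y : u k), ediam (closedBall (y : X) (5 * r k y)) ≤
      ENNReal.ofReal (10 * r k y) := fun k y => by
    have h1 := (hr k y y.2).1
    refine ediam_le_of_forall_dist_le fun a ha b hb => ?_
    rw [mem_closedBall] at ha hb
    linarith [dist_triangle_right a b y]
  have key := Measure.hausdorffMeasure_le_liminf_tsum n (Z ∩ ball x₀ N)
    (fun k : ℕ => ENNReal.ofReal (1 / ((k : ℝ) + 1))) hlim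
    (fun k (y : u k) => closedBall (y : X) (5 * r k y))
    (.of_forall fun k y => (hdiam k y).trans (ENNReal.ofReal_le_ofReal (hr k y y.2).2))
    (.of_forall hcov)
  refine le_antisymm (key.trans ?_) zero_le
  have hlim2 : Tendsto (fun k : ℕ => ENNReal.ofReal 10 ^ n *
      (ENNReal.ofReal (1 / ((k : ℝ) + 1)) * μH[n] (ball x₀ (N + 1)))) atTop (nhds 0) := by
    have h1 := ENNReal.Tendsto.mul_const hlim
      (Or.inr (measure_ball_lt_top (μ := (μH[n] : Measure X)) (x := x₀) (r := N + 1)).ne)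
    have h2 := ENNReal.Tendsto.const_mul h1
      (Or.inr (ENNReal.rpow_ne_top_of_nonneg hn.le (ENNReal.ofReal_ne_top (r := 10))))
    rwa [zero_mul, mul_zero] at h2
  rw [← hlim2.liminf_eq]
  refine liminf_le_liminf (.of_forall fun k => ?_)
  calc _ ≤ ∑' y : u k, ENNReal.ofReal 10 ^ n * ENNReal.ofReal (r k y) ^ n := by
        refine ENNReal.tsum_le_tsum fun y => ?_
        rw [← ENNReal.mul_rpow_of_nonneg _ _ hn.le, ← ENNReal.ofReal_mul (by norm_num)]
        exact ENNReal.rpow_le_rpow (hdiam k y) hn.le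
    _ ≤ _ := by
        rw [ENNReal.tsum_mul_left]
        gcongr
        exact hsum k

end

end BusemannMCP

/-! ### Regular points -/

namespace BusemannMCP

section

variable {X : Type*} [MetricSpace X] [MeasurableSpace X] [ProperSpace X] [BorelSpace X]
  {m : Measure X} [IsLocallyFiniteMeasure m]

theorem AsymptoticBishopGromov.eventually_doubling {n : ℝ} {x : X}
    (h : AsymptoticBishopGromov m n x) :
    ∀ᶠ r in nhdsWithin (0 : ℝ) (Set.Ioi 0), m (closedBall x (3 * r)) ≤
      (Real.toNNReal (2 * 4 ^ n) : NNReal) * m (closedBall x r) := by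
  obtain ⟨R, hR, H⟩ := h (1 / 2) (by norm_num)
  filter_upwards [Ioo_mem_nhdsGT (show (0 : ℝ) < R / 4 by positivity)] with r hr
  have h1 := H x (mem_ball_self hR) r (4 * r) hr.1 (by linarith [hr.1]) (by linarith [hr.2])
  have h2 : r / (4 * r) = 4⁻¹ := by have := hr.1; field_simp
  have h4 : (0 : ℝ) < 4 ^ n := by positivity
  rw [h2, Real.inv_rpow (by norm_num)] at h1
  have h3 : m.real (ball x (4 * r)) ≤ 2 * 4 ^ n * m.real (ball x r) := by
    have := mul_le_mul_of_nonneg_left h1 (show 0 ≤ 2 * (4 : ℝ) ^ n by positivity)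
    refine le_of_eq_of_le ?_ this
    field_simp
    norm_num
  calc m (closedBall x (3 * r)) ≤ m (ball x (4 * r)) :=
        measure_mono (closedBall_subset_ball (by linarith [hr.1]))
    _ = ENNReal.ofReal (m.real (ball x (4 * r))) := (ofReal_measureReal measure_ball_lt_top.ne).symm
    _ ≤ ENNReal.ofReal (2 * 4 ^ n * m.real (ball x r)) := ENNReal.ofReal_le_ofReal h3
    _ = (Real.toNNReal (2 * 4 ^ n) : NNReal) * m (ball x r) := by
        rw [ENNReal.ofReal_mul (by positivity), ofReal_measureReal measure_ball_lt_top.ne]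
        rfl
    _ ≤ _ := by gcongr; exact ball_subset_closedBall

/-- The set `F` is asymptotically dense at `x` at small scales. -/
def IsAsymptoticallyDense (F : Set X) (x : X) : Prop :=
  ∀ C > 0, ∀ κ > 0, ∃ r > 0, ∀ t, 0 < t → t < r → ∀ y, dist x y ≤ C * t →
    ∃ z ∈ F, dist y z < κ * t

theorem ae_isAsymptoticallyDense [m.IsOpenPosMeasure] {n : ℝ}
    (h : ∀ x, AsymptoticBishopGromov m n x) (F : Set X) :
    ∀ᵐ x ∂m, x ∈ F → IsAsymptoticallyDense F x := by
  have hv := ae_imp_of_ae_restrict (VitaliFamily.ae_tendsto_measure_inter_div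
    (Vitali.vitaliFamily m _ fun x => (h x).eventually_doubling.frequently) F)
  filter_upwards [hv] with x hx hxF C hC κ hκ
  have hx := hx hxF
  obtain ⟨R, hR, H⟩ := h x (1 / 2) (by norm_num)
  set δ : ℝ := 1 / 2 * (κ / (2 * (C + κ))) ^ n with hδ
  have hδ0 : 0 < δ := by positivity
  have hballs : Tendsto (fun ρ : ℝ => closedBall x ρ) (nhdsWithin 0 (Set.Ioi 0))
      ((Vitali.vitaliFamily m _ fun x => (h x).eventually_doubling.frequently).filterAt x) := by
    refine (VitaliFamily.tendsto_filterAt_iff _).2 ⟨?_, fun ε hε => ?_⟩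
    · filter_upwards [(h x).eventually_doubling, self_mem_nhdsWithin] with r hr hr0
      exact ⟨isClosed_closedBall, (nonempty_ball.2 hr0).mono ball_subset_interior_closedBall,
        r, subset_rfl, hr⟩
    · filter_upwards [Ioc_mem_nhdsGT hε] with r hr
      exact closedBall_subset_closedBall hr.2
  obtain ⟨ρ₀, hρ₀, Hρ⟩ := mem_nhdsGT_iff_exists_Ioo_subset.1 ((hx.comp hballs).eventually_const_lt
    (show ENNReal.ofReal (1 - δ) < 1 by rw [ENNReal.ofReal_lt_one]; linarith))
  rw [Set.mem_Ioi] at hρ₀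
  refine ⟨min (R / (2 * (C + κ))) (ρ₀ / (C + κ)), by positivity, fun t ht htr y hy => ?_⟩
  have ht1 : 2 * (C + κ) * t < R := by
    have := htr.trans_le (min_le_left _ _)
    rwa [lt_div_iff₀ (by positivity), mul_comm] at this
  have ht2 : (C + κ) * t < ρ₀ := by
    have := htr.trans_le (min_le_right _ _)
    rwa [lt_div_iff₀ (by positivity), mul_comm] at this
  have hCt : 0 < C * t := by positivity
  have hκt : 0 < κ * t := by positivity
  by_contra! hcon
  set B := closedBall x ((C + κ) * t) with hB
  have h1 := H y (by rw [mem_ball']; linarith) (κ * t) (2 * (C + κ) * t) hκt (by linarith) ht1.le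
  have h2 : κ * t / (2 * (C + κ) * t) = κ / (2 * (C + κ)) := by field_simp
  rw [h2, show (1 : ℝ) - 1 / 2 = 1 / 2 by norm_num, ← hδ] at h1
  have hBfin : m B ≠ ∞ := measure_closedBall_lt_top.ne
  have h3 : m.real B ≤ m.real (ball y (2 * (C + κ) * t)) :=
    measureReal_mono (fun z hz => by
      rw [mem_closedBall] at hz
      rw [mem_ball]
      linarith [dist_triangle z x y]) measure_ball_lt_top.ne
  have h4 : (1 - δ) * m.real B < m.real (F ∩ B) := by
    have h5 : ENNReal.ofReal (1 - δ) < m (F ∩ B) / m B := Hρ ⟨by positivity, ht2⟩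
    have h6 := ENNReal.mul_lt_of_lt_div h5
    rw [← ofReal_measureReal hBfin, ← ENNReal.ofReal_mul' measureReal_nonneg] at h6
    by_contra! h7
    refine h6.not_ge ?_
    rw [← ofReal_measureReal (measure_ne_top_of_subset Set.inter_subset_right hBfin)]
    exact ENNReal.ofReal_le_ofReal h7
  have h5 : m.real (F ∩ B) + m.real (ball y (κ * t)) ≤ m.real B := by
    rw [← measureReal_union _ measurableSet_ball (by finiteness) measure_ball_lt_top.ne]
    · refine measureReal_mono (Set.union_subset Set.inter_subset_right fun z hz => ?_) hBfin
      rw [mem_ball] at hz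
      rw [hB, mem_closedBall]
      linarith [dist_triangle z y x, dist_comm x y]
    · rw [Set.disjoint_left]
      rintro z hz hz'
      rw [mem_ball'] at hz'
      exact absurd hz' (not_lt.2 (hcon z hz.1))
  nlinarith

/-- Points with an asymptotic volume `θ`. -/
structure IsRegularPoint (m : Measure X) (n : ℝ) (x : X) (θ : ℝ) : Prop where
  pos : 0 < θ
  lower : ∀ ε > 0, ∃ R > 0, ∀ y ∈ ball x R, ∀ s, 0 < s → s < R →
    (1 - ε) * θ * s ^ n ≤ m.real (ball y s)
  upper : ∀ ε > 0, ∀ C > 0, ∀ η > 0, ∃ r > 0, ∀ t, 0 < t → t < r → ∀ y, dist x y ≤ C * t →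
    ∀ s, η * t ≤ s → s ≤ C * t → m.real (ball y s) ≤ (1 + ε) * θ * s ^ n

theorem exists_small {f : ℝ → ℝ} {a : ℝ} (hf : ContinuousAt f 0) (h : a < f 0) :
    ∃ δ, 0 < δ ∧ δ < 1 ∧ a < f δ := by
  have h1 : ∀ᶠ δ in nhdsWithin (0 : ℝ) (Set.Ioi 0), a < f δ :=
    (hf.eventually_const_lt h).filter_mono nhdsWithin_le_nhds
  obtain ⟨δ, h2, h3⟩ := (h1.and (Ioo_mem_nhdsGT one_pos)).exists
  exact ⟨δ, h3.1, h3.2, h2⟩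

theorem exists_isRegularPoint [m.IsOpenPosMeasure] {n : ℝ} {x : X}
    (h : AsymptoticBishopGromov m n x) (hx : ∃ c, x ∈ lowDensity m n c)
    (hd : ∀ q : ℚ, x ∈ lowDensity m n q → IsAsymptoticallyDense (lowDensity m n q) x) :
    ∃ θ, IsRegularPoint m n x θ := by
  set S := {c : ℝ | x ∈ lowDensity m n c} with hS
  have hSne : S.Nonempty := hx
  have hlow : ∃ c₀ > 0, ∀ c ∈ S, c₀ ≤ c := by
    obtain ⟨R, hR, H⟩ := h (1 / 2) (by norm_num)
    have hpos : 0 < m.real (ball x R) :=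
      ENNReal.toReal_pos (measure_ball_pos m x hR).ne' measure_ball_lt_top.ne
    refine ⟨1 / 2 * m.real (ball x R) / R ^ n, by positivity, fun c hc => ?_⟩
    obtain ⟨r, hr, hr0, hrR⟩ := (hc.and_eventually (Ioo_mem_nhdsGT hR)).exists
    have h1 := (H x (mem_ball_self hR) r R hr0 hrR.le le_rfl).trans hr
    rw [Real.div_rpow hr0.le hR.le] at h1
    have h2 : 0 < r ^ n := by positivity
    rw [div_le_iff₀ (by positivity)]
    have h3 : 0 < R ^ n := by positivity
    have h4 : (1 - 1 / 2) * (r ^ n / R ^ n) * m.real (ball x R) =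
      1 / 2 * m.real (ball x R) / R ^ n * r ^ n := by ring
    rw [h4] at h1
    have h5 := le_of_mul_le_mul_right h1 h2
    rwa [div_le_iff₀ h3] at h5
  obtain ⟨c₀, hc₀, hlow⟩ := hlow
  set θ := sInf S with hθ
  have hθ0 : 0 < θ := hc₀.trans_le (le_csInf hSne hlow)
  refine ⟨θ, hθ0, fun ε hε => ?_, fun ε hε C hC η hη => ?_⟩
  · obtain ⟨δ, hδ0, hδ1, hδ⟩ := exists_small (f := fun δ : ℝ => (1 - δ) ^ 2 * (1 - δ) ^ n)
      (a := 1 - ε) (by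
        refine ContinuousAt.mul (by fun_prop) (ContinuousAt.rpow_const (by fun_prop) ?_)
        simp) (by simp [hε])
    have h1 : (1 - δ) * θ ∉ S := fun h' => by
      have := csInf_le ⟨c₀, hlow⟩ h'
      nlinarith
    obtain ⟨r, hr, Hr⟩ := mem_nhdsGT_iff_exists_Ioo_subset.1 (not_frequently.1 h1)
    rw [Set.mem_Ioi] at hr
    obtain ⟨R, hR, H⟩ := h δ hδ0
    set ρ := min r R / 2 with hρ
    have hρ0 : 0 < ρ := half_pos (lt_min hr hR)
    have hρr : ρ < r := by have := min_le_left r R; linarith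
    have hρR : ρ < R := by have := min_le_right r R; linarith
    refine ⟨δ * ρ, by positivity, fun y hy s hs hsρ => ?_⟩
    have hδρ : δ * ρ < ρ := by nlinarith
    have h2 := H y (ball_subset_ball (by linarith) hy) s ρ hs (by linarith) hρR.le
    have h3 : (1 - δ) * ρ ∈ Set.Ioo 0 r := ⟨mul_pos (by linarith) hρ0, by nlinarith⟩
    have h4 := not_le.1 (Hr h3)
    have h5 : m.real (ball x ((1 - δ) * ρ)) ≤ m.real (ball y ρ) :=
      measureReal_mono (ball_subset_ball' (by rw [mem_ball'] at hy; linarith))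
        measure_ball_lt_top.ne
    rw [Real.mul_rpow (by linarith) hρ0.le] at h4
    have h6 : 0 < ρ ^ n := by positivity
    have h7 : 0 < s ^ n := by positivity
    calc (1 - ε) * θ * s ^ n ≤ (1 - δ) ^ 2 * (1 - δ) ^ n * θ * s ^ n := by gcongr
      _ = (1 - δ) * (s / ρ) ^ n * ((1 - δ) * θ * ((1 - δ) ^ n * ρ ^ n)) := by
          rw [Real.div_rpow hs.le hρ0.le]; field_simp
      _ ≤ (1 - δ) * (s / ρ) ^ n * m.real (ball y ρ) := by
          have : 0 ≤ 1 - δ := by linarith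
          gcongr
          exact h4.le.trans h5
      _ ≤ _ := h2
  · obtain ⟨δ, hδ0, hδ1, hδ⟩ := exists_small
      (f := fun δ : ℝ => -((1 + δ) * (1 + δ) ^ n / (1 - δ))) (a := -(1 + ε)) (by
        refine (ContinuousAt.div (ContinuousAt.mul (by fun_prop)
          (ContinuousAt.rpow_const (by fun_prop) ?_)) (by fun_prop) ?_).neg <;> simp)
      (by simp [hε])
    obtain ⟨q, hq1, hq2⟩ := exists_rat_btwn (show θ < (1 + δ) * θ by nlinarith)
    obtain ⟨c, hc, hcq⟩ := exists_lt_of_csInf_lt hSne hq1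
    have hqS : x ∈ lowDensity m n q := lowDensity_mono hcq.le hc
    obtain ⟨r, hr, Hr⟩ := hd q hqS C hC (δ * η) (by positivity)
    obtain ⟨R, hR, H⟩ := h δ hδ0
    refine ⟨min r (R / (2 * C + δ * η)), by positivity, fun t ht htr y hy s hs hs' => ?_⟩
    have hs0 : 0 < s := (mul_pos hη ht).trans_le hs
    obtain ⟨z, hz, hyz⟩ := Hr t ht (htr.trans_le (min_le_left _ _)) y hy
    have htR : (2 * C + δ * η) * t < R := by
      have := htr.trans_le (min_le_right _ _)
      rwa [lt_div_iff₀ (by positivity), mul_comm] at this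
    have hδs : δ * η * t ≤ δ * s := by rw [mul_assoc]; gcongr
    have hδs' : δ * s ≤ s := by nlinarith
    have hzR : z ∈ ball x R := by
      rw [mem_ball']
      have : 0 < C * t := by positivity
      linarith [dist_triangle x y z]
    have hsR : (1 + δ) * s ≤ R := by
      have : 0 < δ * η * t := by positivity
      linarith
    have h1 : (1 - δ) * m.real (ball z ((1 + δ) * s)) ≤ q * ((1 + δ) * s) ^ n := by
      obtain ⟨r', hr', hr0, hrs⟩ := (hz.and_eventually
        (Ioo_mem_nhdsGT (show 0 < (1 + δ) * s by positivity))).exists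
      have h2 := (H z hzR r' _ hr0 hrs.le hsR).trans hr'
      rw [Real.div_rpow hr0.le (by positivity)] at h2
      have h3 : 0 < r' ^ n := by positivity
      have h4 : 0 < ((1 + δ) * s) ^ n := by positivity
      have h5 : (1 - δ) * (r' ^ n / ((1 + δ) * s) ^ n) * m.real (ball z ((1 + δ) * s)) =
        (1 - δ) * m.real (ball z ((1 + δ) * s)) / ((1 + δ) * s) ^ n * r' ^ n := by ring
      rw [h5] at h2
      have h6 := le_of_mul_le_mul_right h2 h3
      rwa [div_le_iff₀ h4] at h6
    have h2 : m.real (ball y s) ≤ m.real (ball z ((1 + δ) * s)) :=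
      measureReal_mono (ball_subset_ball' (by linarith)) measure_ball_lt_top.ne
    have h3 : 0 < 1 - δ := by linarith
    rw [← le_div_iff₀' h3] at h1
    have h4 : 0 < s ^ n := by positivity
    calc m.real (ball y s) ≤ q * ((1 + δ) * s) ^ n / (1 - δ) := h2.trans h1
      _ ≤ (1 + δ) * θ * ((1 + δ) * s) ^ n / (1 - δ) := by gcongr
      _ = (1 + δ) * (1 + δ) ^ n / (1 - δ) * θ * s ^ n := by
          rw [Real.mul_rpow (by linarith) hs0.le]; ring
      _ ≤ _ := by
          have := (neg_lt_neg_iff.1 hδ).le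
          gcongr

end

theorem ae_exists_isRegularPoint {X : Type*} [MetricSpace X] [MeasurableSpace X] [ProperSpace X]
    [BorelSpace X] {n : ℝ} (hn : 0 < n) [IsLocallyFiniteMeasure (μH[n] : Measure X)]
    [(μH[n] : Measure X).IsOpenPosMeasure] (h : ∀ x : X, AsymptoticBishopGromov μH[n] n x) :
    ∀ᵐ x : X ∂μH[n], ∃ θ, IsRegularPoint μH[n] n x θ := by
  have h1 : ∀ᵐ x : X ∂μH[n], ∃ c, x ∈ lowDensity μH[n] n c := by
    rw [ae_iff]
    simpa only [not_exists] using hausdorffMeasure_forall_notMem_lowDensity (X := X) hn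
  have h2 : ∀ᵐ x : X ∂μH[n], ∀ q : ℚ, x ∈ lowDensity μH[n] n q →
      IsAsymptoticallyDense (lowDensity μH[n] n q) x :=
    ae_all_iff.2 fun q => ae_isAsymptoticallyDense h _
  filter_upwards [h1, h2] with x hx1 hx2
  exact exists_isRegularPoint (h x) hx1 hx2

end BusemannMCP

/-! ### Contractions at regular points -/

namespace BusemannMCP

section

variable {X : Type*} [MetricSpace X] [MeasurableSpace X] [ProperSpace X] [BorelSpace X]
  {m : Measure X} [IsLocallyFiniteMeasure m] {n θ : ℝ} {x : X} {r₀ : ℝ}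
  {L : LocalGeodesicStructure X (ball x r₀)}

theorem image_ball_subset {p y : X} {s t : ℝ} (ht : 0 < t)
    (hconv : ∀ a ∈ ball y s, dist (L.σ p y t) (L.σ p a t) ≤ t * dist y a) :
    (fun a => L.σ p a t) '' ball y s ⊆ ball (L.σ p y t) (t * s) := by
  rintro _ ⟨a, ha, rfl⟩
  rw [mem_ball']
  refine (hconv a ha).trans_lt ?_
  rw [mem_ball'] at ha
  gcongr

/-- Two disjoint sets inside a ball have total volume at most that of the ball. -/
theorem add_measureReal_le_of_disjoint {S : Set X} {y z : X} {r s : ℝ} (hS : S ⊆ ball y r)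
    (hz : ball z s ⊆ ball y r) (hdisj : Disjoint S (ball z s)) :
    m.real S + m.real (ball z s) ≤ m.real (ball y r) := by
  rw [← measureReal_union hdisj measurableSet_ball
    (measure_ne_top_of_subset hS measure_ball_lt_top.ne) measure_ball_lt_top.ne]
  exact measureReal_mono (Set.union_subset hS hz) measure_ball_lt_top.ne

theorem IsRegularPoint.exists_comparison (hx : IsRegularPoint m n x θ) (hr₀ : 0 < r₀)
    (hV : VolumeContraction m n L) {ε C η : ℝ} (hε : 0 < ε) (hC : 0 < C) (hη : 0 < η) :
    ∃ r₁ > 0, ∀ r, 0 < r → r < r₁ → C * r < r₀ ∧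
      (∀ y, dist x y ≤ C * r → ∀ s, η * r ≤ s → s ≤ C * r →
        m.real (ball y s) ≤ (1 + ε) * θ * s ^ n) ∧
      (∀ y, dist x y ≤ C * r → ∀ s, 0 < s → s ≤ C * r →
        (1 - ε) * θ * s ^ n ≤ m.real (ball y s)) ∧
      ∀ p, dist x p ≤ C * r → ∀ A ⊆ closedBall x (C * r), MeasurableSet A →
        ∀ t ∈ Set.Icc (0 : ℝ) 1,
        (1 - ε) * t ^ n * m.real A ≤ m.real ((fun a => L.σ p a t) '' A) := by
  obtain ⟨R₁, hR₁, H₁⟩ := hx.lower ε hε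
  obtain ⟨R₂, hR₂, H₂⟩ := hx.upper ε hε C hC η hη
  obtain ⟨R₃, hR₃, H₃⟩ := hV ε hε
  refine ⟨min (r₀ / C) (min (R₁ / C) (min R₂ (R₃ / C))), by positivity, fun r hr hrr => ?_⟩
  simp only [lt_min_iff] at hrr
  obtain ⟨h0, h1, h2, h3⟩ := hrr
  rw [lt_div_iff₀' hC] at h0 h1 h3
  refine ⟨h0, H₂ r hr h2, fun y hy s hs hs' => H₁ y (mem_ball'.2 (by linarith)) s hs (by linarith),
    fun p hp A hA => H₃ p (mem_ball'.2 (by linarith)) A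
      (hA.trans (closedBall_subset_ball h3))⟩

theorem IsRegularPoint.expanding (hx : IsRegularPoint m n x θ) (hn : 0 < n) (hr₀ : 0 < r₀)
    (hV : VolumeContraction m n L)
    (hconv : ∀ p ∈ ball x r₀, ∀ y ∈ ball x r₀, ∀ z ∈ ball x r₀, ∀ t ∈ Set.Icc (0 : ℝ) 1,
      dist (L.σ p y t) (L.σ p z t) ≤ t * dist y z)
    {a : ℝ} (ha : 0 < a) (ha1 : a < 1) {ε : ℝ} (hε : 0 < ε) :
    ∃ r₁ > 0, ∀ r, 0 < r → r < r₁ → ∀ c ∈ ball x r, ∀ y ∈ ball x r, ∀ z ∈ ball x r,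
      a * dist y z - ε * r ≤ dist (L.σ c y a) (L.σ c z a) := by
  obtain ⟨δ, hδ0, hδ1, hδ⟩ := exists_small
    (f := fun δ : ℝ => (1 - δ) * (ε / 2) ^ n - 2 * ((1 + δ) - (1 - δ) ^ 2)) (a := 0) (by fun_prop)
    (by simp only [sub_zero, one_mul, add_zero, one_pow, sub_self, mul_zero]; positivity)
  obtain ⟨r₁, hr₁, H⟩ := hx.exists_comparison (L := L) hr₀ hV hδ0 (C := 5) (η := ε / 2)
    (by norm_num) (by positivity)
  refine ⟨r₁, hr₁, fun r hr hrr c hc y hy z hz => ?_⟩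
  obtain ⟨hsmall, hup, hlow, hcon⟩ := H r hr hrr
  by_contra! hlt
  have hθ := hx.pos
  have hsub : ∀ w, dist x w ≤ 5 * r → w ∈ ball x r₀ := fun w hw => mem_ball'.2 (by linarith)
  have hat : a ∈ Set.Icc (0 : ℝ) 1 := ⟨ha.le, ha1.le⟩
  rw [mem_ball'] at hc hy hz
  set D := dist y z with hD
  have hD2 : D < 2 * r := by linarith [dist_triangle_left y z x]
  set y' := L.σ c y a with hy'
  set z' := L.σ c z a with hz'
  have haD : ε * r < a * D := by linarith [dist_nonneg (x := y') (y := z')]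
  have hεr : 0 < ε * r := by positivity
  have hD0 : 0 < D := pos_of_mul_pos_right (hεr.trans haD) ha.le
  have haDD : a * D < D := by nlinarith
  have hdist' : ∀ w, dist x w < r → dist x (L.σ c w a) < 3 * r := fun w hw => by
    have h1 := LocalGeodesicStructure.dist_left L (hsub c (by linarith)) (hsub w (by linarith)) hat
    have h2 : a * dist c w ≤ 1 * dist c w := by gcongr
    linarith [dist_triangle x c (L.σ c w a), dist_triangle_left c w x]
  have hxy' : dist x y' < 3 * r := hdist' y hy
  have hxz' : dist x z' < 3 * r := hdist' z hz
  have hmy' := hsub y' (by linarith)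
  have hmz' := hsub z' (by linarith)
  have himg : ∀ w, dist x w < r → (fun b => L.σ c b a) '' ball w (D / 2) ⊆
      ball (L.σ c w a) (a * (D / 2)) := fun w hw => by
    refine image_ball_subset ha fun b hb => hconv c (hsub c (by linarith)) w (hsub w (by linarith))
      b (hsub b ?_) a hat
    rw [mem_ball'] at hb
    linarith [dist_triangle x w b]
  set q := L.σ y' z' (1 / 2) with hq
  have hqy : dist y' q = 1 / 2 * dist y' z' :=
    LocalGeodesicStructure.dist_left L hmy' hmz' (by constructor <;> norm_num)
  have hqz : dist z' q = 1 / 2 * dist y' z' := by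
    have := LocalGeodesicStructure.dist_right L hmy' hmz' (a := 1 / 2) (by constructor <;> norm_num)
    rw [this]; norm_num
  have hdisj : Disjoint (ball y (D / 2)) (ball z (D / 2)) := ball_disjoint_ball (by linarith)
  have hA : ball y (D / 2) ∪ ball z (D / 2) ⊆ closedBall x (5 * r) := by
    refine Set.union_subset (fun w hw => ?_) fun w hw => ?_ <;>
    · rw [mem_ball'] at hw
      rw [mem_closedBall']
      linarith [dist_triangle x y w, dist_triangle x z w]
  have h1 := hcon c (by linarith) _ hA (measurableSet_ball.union measurableSet_ball) a hat
  rw [measureReal_union hdisj measurableSet_ball measure_ball_lt_top.ne measure_ball_lt_top.ne,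
    Set.image_union] at h1
  have hBq : ball q (ε * r / 2) ⊆ ball z' (a * (D / 2)) :=
    ball_subset_ball' (by rw [dist_comm, hqz]; linarith)
  have h2 : m.real ((fun b => L.σ c b a) '' ball y (D / 2) ∪
      (fun b => L.σ c b a) '' ball z (D / 2)) ≤
      m.real (ball y' (a * (D / 2))) + (m.real (ball z' (a * (D / 2))) -
        m.real (ball q (ε * r / 2))) := by
    rw [← measureReal_sdiff hBq measurableSet_ball measure_ball_lt_top.ne]
    refine (measureReal_mono ?_ ?_).trans (measureReal_union_le _ _)
    · refine (Set.union_subset_union (himg y hy) (himg z hz)).trans fun w hw => ?_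
      by_cases hwq : w ∈ ball q (ε * r / 2)
      · refine Or.inl (ball_subset_ball' ?_ hwq)
        rw [dist_comm, hqy]; linarith
      · exact hw.imp id fun hw => ⟨hw, hwq⟩
    · exact measure_union_ne_top measure_ball_lt_top.ne
        (measure_ne_top_of_subset Set.sdiff_subset measure_ball_lt_top.ne)
  have h3 := hup y' (by linarith) (a * (D / 2)) (by linarith) (by linarith)
  have h4 := hup z' (by linarith) (a * (D / 2)) (by linarith) (by linarith)
  have h5 := hlow q (by linarith [dist_triangle x y' q]) (ε * r / 2) (by positivity) (by linarith)
  have h6 := hlow y (by linarith) (D / 2) (by positivity) (by linarith)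
  have h7 := hlow z (by linarith) (D / 2) (by positivity) (by linarith)
  rw [Real.mul_rpow ha.le (by positivity)] at h3 h4
  have h8 : (1 - δ) * a ^ n * (2 * ((1 - δ) * θ * (D / 2) ^ n)) ≤
      (1 - δ) * a ^ n * (m.real (ball y (D / 2)) + m.real (ball z (D / 2))) := by
    have : 0 < 1 - δ := by linarith
    gcongr
    linarith
  have h9 : a ^ n * (D / 2) ^ n ≤ r ^ n := by
    rw [← Real.mul_rpow ha.le (by positivity)]
    exact Real.rpow_le_rpow (by positivity) (by linarith) hn.le
  have h10 : (ε * r / 2) ^ n = (ε / 2) ^ n * r ^ n := by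
    rw [← Real.mul_rpow (by positivity) hr.le]; ring_nf
  rw [h10] at h5
  have h11 : θ * ((1 - δ) * (ε / 2) ^ n * r ^ n) ≤
      θ * (2 * ((1 + δ) - (1 - δ) ^ 2) * (a ^ n * (D / 2) ^ n)) := by linarith
  have h12 := le_of_mul_le_mul_left h11 hθ
  have h13 : 2 * ((1 + δ) - (1 - δ) ^ 2) * (a ^ n * (D / 2) ^ n) ≤
      2 * ((1 + δ) - (1 - δ) ^ 2) * r ^ n :=
    mul_le_mul_of_nonneg_left h9 (by nlinarith)
  have h14 : 0 < r ^ n := by positivity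
  have h15 := mul_pos hδ h14
  linarith

theorem IsRegularPoint.surjective (hx : IsRegularPoint m n x θ) (hr₀ : 0 < r₀)
    (hV : VolumeContraction m n L) {a : ℝ} (ha : 0 < a) (ha1 : a < 1) {ε : ℝ} (hε : 0 < ε) :
    ∃ r₁ > 0, ∀ r, 0 < r → r < r₁ → ∀ c ∈ ball x r, ∀ y ∈ ball x r,
      ∃ z ∈ ball x (4 * r / a), dist (L.σ c z a) y ≤ ε * r := by
  set e := min ε 1 with he
  have he0 : 0 < e := lt_min hε one_pos
  obtain ⟨δ, hδ0, hδ1, hδ⟩ := exists_small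
    (f := fun δ : ℝ => (1 - δ) ^ 2 * 3 ^ n + (1 - δ) * e ^ n - (1 + δ) * 3 ^ n) (a := 0)
    (by fun_prop)
    (by simp only [sub_zero, one_mul, add_zero, one_pow, add_sub_cancel_left]; positivity)
  obtain ⟨r₁, hr₁, H⟩ := hx.exists_comparison (L := L) hr₀ hV hδ0 (C := 4 / a) (η := 1)
    (by positivity) one_pos
  refine ⟨r₁, hr₁, fun r hr hrr c hc y hy => ?_⟩
  obtain ⟨hsmall, hup, hlow, hcon⟩ := H r hr hrr
  have hθ := hx.pos
  rw [mem_ball'] at hc hy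
  have h4 : 4 * r < 4 / a * r := by
    have : 4 < 4 / a := by rw [lt_div_iff₀ ha]; linarith
    gcongr
  have h4' : 4 / a * r = 4 * r / a := by ring
  have h3r : r + 3 * r / a < 4 / a * r := by
    have h5 : r < r / a := by rw [lt_div_iff₀ ha]; nlinarith
    have h6 : 4 / a * r = r / a + 3 * r / a := by ring
    linarith
  have hat : a ∈ Set.Icc (0 : ℝ) 1 := ⟨ha.le, ha1.le⟩
  have hball : ∀ z ∈ ball c (3 * r / a), dist x z < 4 / a * r := fun z hz => by
    rw [mem_ball'] at hz
    linarith [dist_triangle x c z]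
  by_contra! hno
  have her : e * r ≤ r := by nlinarith [min_le_right ε 1]
  have her' : e * r ≤ ε * r := by gcongr; exact min_le_left ε 1
  have h1 := hcon c (by linarith) (ball c (3 * r / a))
    (fun z hz => mem_closedBall'.2 (hball z hz).le) measurableSet_ball a hat
  have h2 : m.real ((fun b => L.σ c b a) '' ball c (3 * r / a)) + m.real (ball y (e * r)) ≤
      m.real (ball c (3 * r)) := by
    refine add_measureReal_le_of_disjoint ?_ (ball_subset_ball' ?_) ?_
    · rintro _ ⟨b, hb, rfl⟩
      rw [mem_ball', LocalGeodesicStructure.dist_left L (mem_ball'.2 (by linarith))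
        (mem_ball'.2 (by linarith [hball b hb])) hat]
      rw [mem_ball'] at hb
      calc a * dist c b < a * (3 * r / a) := by gcongr
        _ = 3 * r := by field_simp
    · linarith [dist_triangle_left y c x]
    · rw [Set.disjoint_left]
      rintro _ ⟨b, hb, rfl⟩ hb'
      rw [mem_ball] at hb'
      have := hno b (mem_ball'.2 ((hball b hb).trans_eq h4'))
      linarith
  have h5 := hup c (by linarith) (3 * r) (by linarith) (by linarith)
  have h6 := hlow y (by linarith) (e * r) (by positivity) (by linarith)
  have h7 := hlow c (by linarith) (3 * r / a) (by positivity) (by linarith)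
  have h8 : (1 - δ) * a ^ n * ((1 - δ) * θ * (3 * r / a) ^ n) ≤
      (1 - δ) * a ^ n * m.real (ball c (3 * r / a)) := by
    have : 0 < 1 - δ := by linarith
    gcongr
  have han : 0 < a ^ n := by positivity
  rw [Real.div_rpow (by positivity) ha.le, Real.mul_rpow (by norm_num) hr.le] at h8
  rw [Real.mul_rpow he0.le hr.le] at h6
  rw [Real.mul_rpow (by norm_num) hr.le] at h5
  have h9 : (1 - δ) * a ^ n * ((1 - δ) * θ * (3 ^ n * r ^ n / a ^ n)) =
      θ * r ^ n * ((1 - δ) ^ 2 * 3 ^ n) := by field_simp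
  rw [h9] at h8
  have h10 : 0 < θ * r ^ n := by positivity
  have h11 : θ * r ^ n * ((1 - δ) ^ 2 * 3 ^ n + (1 - δ) * e ^ n) ≤
      θ * r ^ n * ((1 + δ) * 3 ^ n) := by linarith
  have h12 := le_of_mul_le_mul_left h11 h10
  linarith

theorem IsRegularPoint.injective (hx : IsRegularPoint m n x θ) (hn : 0 < n) (hr₀ : 0 < r₀)
    (hV : VolumeContraction m n L)
    (hconv : ∀ p ∈ ball x r₀, ∀ y ∈ ball x r₀, ∀ z ∈ ball x r₀, ∀ t ∈ Set.Icc (0 : ℝ) 1,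
      dist (L.σ p y t) (L.σ p z t) ≤ t * dist y z) :
    ∃ C > 0, ∃ R > 0, ∀ y ∈ ball x R, ∀ z ∈ ball x R,
      ∀ᶠ t in nhdsWithin (0 : ℝ) (Set.Ioi 0), C * t * dist y z ≤ dist (L.σ x y t) (L.σ x z t) := by
  have hθ := hx.pos
  obtain ⟨R₁, hR₁, H₁⟩ := hx.lower (1 / 8) (by norm_num)
  obtain ⟨R₂, hR₂, H₂⟩ := hV (1 / 8) (by norm_num)
  obtain ⟨C, hC, hCn⟩ : ∃ C : ℝ, 0 < C ∧ (1 + 2 * C) ^ n = 5 / 4 := by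
    have h1 : 1 < (5 / 4 : ℝ) ^ n⁻¹ := Real.one_lt_rpow (by norm_num) (by positivity)
    refine ⟨((5 / 4 : ℝ) ^ n⁻¹ - 1) / 2, by linarith, ?_⟩
    rw [mul_div_cancel₀ _ two_ne_zero, add_sub_cancel, Real.rpow_inv_rpow (by norm_num) hn.ne']
  obtain ⟨R, hR, hRr, hRR₁, hRR₂⟩ : ∃ R > 0, 2 * R < r₀ ∧ R < R₁ ∧ 2 * R < R₂ := by
    refine ⟨min r₀ (min R₁ R₂) / 3, by positivity, ?_, ?_, ?_⟩ <;>
    linarith [min_le_left r₀ (min R₁ R₂), min_le_right r₀ (min R₁ R₂), min_le_left R₁ R₂,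
      min_le_right R₁ R₂, lt_min hr₀ (lt_min hR₁ hR₂)]
  refine ⟨C, hC, R, hR, fun y hy z hz => ?_⟩
  rw [mem_ball'] at hy hz
  rcases eq_or_ne y z with rfl | hyz
  · exact .of_forall fun t => by simp
  set s := dist y z / 2 with hs
  have hs0 : 0 < s := half_pos (dist_pos.2 hyz)
  have hsR : s < R := by linarith [dist_triangle_left y z x]
  set q := s * (1 + 2 * C) with hq
  have hq0 : 0 < q := by positivity
  obtain ⟨t₀, ht₀, H₃⟩ := hx.upper (1 / 8) (by norm_num) (R + q) (by positivity) q hq0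
  filter_upwards [Ioo_mem_nhdsGT (lt_min one_pos ht₀)] with t ht
  have ht0 : 0 < t := ht.1
  have ht1 : t < 1 := ht.2.trans_le (min_le_left _ _)
  have htt : t ∈ Set.Icc (0 : ℝ) 1 := ⟨ht0.le, ht1.le⟩
  have hxr : x ∈ ball x r₀ := mem_ball_self hr₀
  by_contra! hlt
  have hsub : ∀ w, dist x w < R → ball w s ⊆ ball x (2 * R) := fun w hw =>
    ball_subset_ball' (by rw [dist_comm]; linarith)
  have hdisj : Disjoint (ball y s) (ball z s) := ball_disjoint_ball (by linarith)
  have himg : ∀ w, dist x w < R → (fun b => L.σ x b t) '' ball w s ⊆ ball (L.σ x w t) (t * s) :=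
    fun w hw => image_ball_subset ht0 fun b hb => hconv x hxr w
      (mem_ball'.2 (by linarith)) b (ball_subset_ball hRr.le (hsub w hw hb)) t htt
  have h1 := H₂ x (mem_ball_self hR₂) (ball y s ∪ ball z s)
    ((Set.union_subset (hsub y hy) (hsub z hz)).trans (ball_subset_ball hRR₂.le))
    (measurableSet_ball.union measurableSet_ball) t htt
  rw [measureReal_union hdisj measurableSet_ball measure_ball_lt_top.ne measure_ball_lt_top.ne,
    Set.image_union] at h1
  have h2 : m.real ((fun b => L.σ x b t) '' ball y s ∪ (fun b => L.σ x b t) '' ball z s) ≤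
      m.real (ball (L.σ x y t) (t * q)) := by
    refine measureReal_mono (Set.union_subset ?_ ?_) measure_ball_lt_top.ne
    · refine (himg y hy).trans (ball_subset_ball ?_)
      have : s ≤ q := by nlinarith
      gcongr
    · refine (himg z hz).trans (ball_subset_ball' ?_)
      rw [dist_comm, hq]
      have h3 : dist y z = 2 * s := by ring
      rw [h3] at hlt
      linarith
  have h3 := H₃ t ht0 (ht.2.trans_le (min_le_right _ _)) (L.σ x y t) (by
    rw [LocalGeodesicStructure.dist_left L hxr (mem_ball'.2 (by linarith)) htt, mul_comm]
    gcongr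
    linarith) (t * q) (mul_comm _ _).le (by nlinarith)
  have h4 := H₁ y (mem_ball'.2 (by linarith)) s hs0 (by linarith)
  have h5 := H₁ z (mem_ball'.2 (by linarith)) s hs0 (by linarith)
  rw [hq, Real.mul_rpow ht0.le (by positivity), Real.mul_rpow hs0.le (by positivity), hCn] at h3
  have htn : 0 < t ^ n := by positivity
  have hsn : 0 < s ^ n := by positivity
  have h6 : (1 - 1 / 8) * t ^ n * (2 * ((1 - 1 / 8) * θ * s ^ n)) ≤
      (1 - 1 / 8) * t ^ n * (m.real (ball y s) + m.real (ball z s)) := by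
    have : (0 : ℝ) ≤ 1 - 1 / 8 := by norm_num
    gcongr
    linarith
  have h7 : 0 < t ^ n * (θ * s ^ n) := by positivity
  linarith

theorem IsRegularPoint.exists_preimage (hx : IsRegularPoint m n x θ) (hr₀ : 0 < r₀)
    (hV : VolumeContraction m n L)
    (hconv : ∀ p ∈ ball x r₀, ∀ y ∈ ball x r₀, ∀ z ∈ ball x r₀, ∀ t ∈ Set.Icc (0 : ℝ) 1,
      dist (L.σ p y t) (L.σ p z t) ≤ t * dist y z) :
    ∃ R > 0, ∀ w ∈ ball x R, ∀ s, 0 < s → s < R →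
      ∀ᶠ t in nhdsWithin (0 : ℝ) (Set.Ioi 0), ∀ u, dist u (L.σ x w t) ≤ 5 / 8 * t * s →
        ∃ b ∈ ball w s, dist u (L.σ x b t) < t * s / 4 := by
  have hθ := hx.pos
  obtain ⟨δ, hδ0, hδ1, hδ⟩ := exists_small
    (f := fun δ : ℝ => (1 - δ) ^ 2 + (1 - δ) * (1 / 4) ^ n - (1 + δ)) (a := 0) (by fun_prop)
    (by simp only [sub_zero, one_mul, add_zero, one_pow, add_sub_cancel_left]; positivity)
  obtain ⟨R₁, hR₁, H₁⟩ := hx.lower δ hδ0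
  obtain ⟨R₂, hR₂, H₂⟩ := hV δ hδ0
  obtain ⟨R, hR, hRr, hRR₁, hRR₂⟩ : ∃ R > 0, 2 * R < r₀ ∧ 2 * R < R₁ ∧ 2 * R < R₂ := by
    refine ⟨min r₀ (min R₁ R₂) / 3, by positivity, ?_, ?_, ?_⟩ <;>
    linarith [min_le_left r₀ (min R₁ R₂), min_le_right r₀ (min R₁ R₂), min_le_left R₁ R₂,
      min_le_right R₁ R₂, lt_min hr₀ (lt_min hR₁ hR₂)]
  refine ⟨R, hR, fun w hw s hs hsR => ?_⟩
  rw [mem_ball'] at hw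
  obtain ⟨t₀, ht₀, H₃⟩ := hx.upper δ hδ0 (R + s) (by positivity) s hs
  filter_upwards [Ioo_mem_nhdsGT (lt_min one_pos ht₀)] with t ht u hu
  have ht0 : 0 < t := ht.1
  have ht1 : t < 1 := ht.2.trans_le (min_le_left _ _)
  have htt : t ∈ Set.Icc (0 : ℝ) 1 := ⟨ht0.le, ht1.le⟩
  have hxr : x ∈ ball x r₀ := mem_ball_self hr₀
  have hts : t * s < s := by nlinarith
  have hts0 : 0 < t * s := by positivity
  by_contra! hno
  have hsub : ball w s ⊆ ball x (2 * R) := ball_subset_ball' (by rw [dist_comm]; linarith)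
  have h1 := H₂ x (mem_ball_self hR₂) (ball w s) (hsub.trans (ball_subset_ball hRR₂.le))
    measurableSet_ball t htt
  have h2 : m.real ((fun b => L.σ x b t) '' ball w s) + m.real (ball u (t * s / 4)) ≤
      m.real (ball (L.σ x w t) (t * s)) := by
    refine add_measureReal_le_of_disjoint (image_ball_subset ht0 fun b hb => hconv x hxr w
      (mem_ball'.2 (by linarith)) b (ball_subset_ball hRr.le (hsub hb)) t htt)
      (ball_subset_ball' (by linarith)) ?_
    rw [Set.disjoint_left]
    rintro _ ⟨b, hb, rfl⟩ hb'
    rw [mem_ball'] at hb'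
    exact absurd hb' (not_lt.2 (hno b hb))
  have hxw : dist x (L.σ x w t) = t * dist x w :=
    LocalGeodesicStructure.dist_left L hxr (mem_ball'.2 (by linarith)) htt
  have htw : t * dist x w ≤ t * R := by gcongr
  have htR : t * R < R := by nlinarith
  have h3 := H₃ t ht0 (ht.2.trans_le (min_le_right _ _)) (L.σ x w t) (by
    rw [hxw]; linarith) (t * s) (mul_comm _ _).le (by linarith [mul_pos ht0 hR])
  have h4 := H₁ w (mem_ball'.2 (by linarith)) s hs (by linarith)
  have h5 := H₁ u (by
    rw [mem_ball']
    linarith [dist_triangle_right x u (L.σ x w t)]) (t * s / 4) (by positivity) (by linarith)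
  rw [div_eq_mul_one_div, Real.mul_rpow hts0.le (by norm_num)] at h5
  have h6 : (t * s) ^ n = t ^ n * s ^ n := Real.mul_rpow ht0.le hs.le
  have htn : 0 < t ^ n := by positivity
  have h7 : (1 - δ) * t ^ n * ((1 - δ) * θ * s ^ n) ≤ (1 - δ) * t ^ n * m.real (ball w s) := by
    have : 0 < 1 - δ := by linarith
    gcongr
  have h8 : 0 < θ * (t * s) ^ n := by positivity
  have h9 : (1 - δ) * t ^ n * ((1 - δ) * θ * s ^ n) = (1 - δ) ^ 2 * θ * (t * s) ^ n := by
    rw [h6]; ring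
  rw [div_eq_mul_one_div] at h2
  have h10 : θ * (t * s) ^ n * ((1 - δ) ^ 2 + (1 - δ) * (1 / 4) ^ n) ≤
      θ * (t * s) ^ n * (1 + δ) := by linarith
  have h11 := le_of_mul_le_mul_left h10 h8
  linarith

theorem IsRegularPoint.asymptoticDilations (hx : IsRegularPoint m n x θ) (hn : 0 < n)
    (hr₀ : 0 < r₀) (hV : VolumeContraction m n L)
    (hconv : ∀ p ∈ ball x r₀, ∀ y ∈ ball x r₀, ∀ z ∈ ball x r₀, ∀ t ∈ Set.Icc (0 : ℝ) 1,
      dist (L.σ p y t) (L.σ p z t) ≤ t * dist y z) : AsymptoticDilations L where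
  convex := hconv
  expanding _ ha ha1 _ hε := hx.expanding hn hr₀ hV hconv ha ha1 hε
  surjective _ ha ha1 _ hε := hx.surjective hr₀ hV ha ha1 hε

end

end BusemannMCP

/-! ### Manifold points -/

namespace BusemannMCP

theorem isManifoldPoint_of_chart {X : Type*} [MetricSpace X] [ProperSpace X] {E : Type*}
    [NormedAddCommGroup E] [NormedSpace ℝ E] {x : X} {C R : ℝ} {f : X → E} (hC : 0 < C)
    (hR : 0 < R) (hnorm : ∀ y ∈ ball x R, ‖f y‖ = dist x y)
    (hdist : ∀ y ∈ ball x R, ∀ z ∈ ball x R, dist (f y) (f z) ≤ dist y z ∧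
      C * dist y z ≤ dist (f y) (f z))
    (hsurj : ∀ v ∈ ball (0 : E) R, ∃ y ∈ ball x R, f y = v) :
    ∃ k : ℕ, IsManifoldPoint k x ∧ dimH (ball x R) = k := by
  have hf : LipschitzOnWith 1 f (ball x R) :=
    LipschitzOnWith.of_dist_le_mul fun y hy z hz => by
      rw [NNReal.coe_one, one_mul]; exact (hdist y hy z hz).1
  have hmaps : ∀ y ∈ ball x R, f y ∈ ball (0 : E) R := fun y hy => by
    rw [mem_ball_zero_iff, hnorm y hy]; exact mem_ball'.1 hy
  have : Nonempty X := ⟨x⟩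
  choose! g hgR hfg using hsurj
  have hgf : ∀ y ∈ ball x R, g (f y) = y := fun y hy => by
    have h1 := (hdist _ (hgR _ (hmaps y hy)) y hy).2
    rw [hfg _ (hmaps y hy), dist_self] at h1
    exact dist_le_zero.1 (nonpos_of_mul_nonpos_right h1 hC)
  have hg : LipschitzOnWith (Real.toNNReal C⁻¹) g (ball (0 : E) R) :=
    LipschitzOnWith.of_dist_le_mul fun v hv w hw => by
      have h1 := (hdist _ (hgR v hv) _ (hgR w hw)).2
      rw [hfg v hv, hfg w hw] at h1
      rwa [Real.coe_toNNReal _ (by positivity), inv_mul_eq_div, le_div_iff₀' hC]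
  have himg : f '' ball x R = ball 0 R := Set.Subset.antisymm
    (Set.image_subset_iff.2 hmaps) fun v hv => ⟨g v, hgR v hv, hfg v hv⟩
  have himg' : g '' ball 0 R = ball x R := Set.Subset.antisymm
    (Set.image_subset_iff.2 hgR) fun y hy => ⟨f y, hmaps y hy, hgf y hy⟩
  have hfin : FiniteDimensional ℝ E := by
    refine FiniteDimensional.of_isCompact_closedBall ℝ (half_pos hR) (c := (0 : E)) ?_
    have hsub : closedBall x (R / 2) ⊆ ball x R := closedBall_subset_ball (half_lt_self hR)
    have h1 : f '' closedBall x (R / 2) = closedBall 0 (R / 2) := by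
      refine Set.Subset.antisymm (Set.image_subset_iff.2 fun y hy => ?_) fun v hv => ?_
      · rw [Set.mem_preimage, mem_closedBall_zero_iff, hnorm y (hsub hy)]
        exact mem_closedBall'.1 hy
      · have hv' : v ∈ ball (0 : E) R := closedBall_subset_ball (half_lt_self hR) hv
        refine ⟨g v, ?_, hfg v hv'⟩
        rw [mem_closedBall', ← hnorm _ (hgR v hv'), hfg v hv']
        exact mem_closedBall_zero_iff.1 hv
    rw [← h1]
    exact (isCompact_closedBall x (R / 2)).image_of_continuousOn (hf.continuousOn.mono hsub)
  refine ⟨Module.finrank ℝ E, ⟨ball x R, isOpen_ball, mem_ball_self hR, ⟨?_⟩⟩, ?_⟩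
  · have e₁ : ball x R ≃ₜ ball (0 : E) R :=
      { toFun := fun y => ⟨f y, hmaps y y.2⟩
        invFun := fun v => ⟨g v, hgR v v.2⟩
        left_inv := fun y => Subtype.ext (hgf y y.2)
        right_inv := fun v => Subtype.ext (hfg v v.2)
        continuous_toFun :=
          (continuousOn_iff_continuous_domRestrict.1 hf.continuousOn).subtype_mk _
        continuous_invFun :=
          (continuousOn_iff_continuous_domRestrict.1 hg.continuousOn).subtype_mk _ }
    have e₂ : E ≃ₜ ball (0 : E) R :=
      (Homeomorph.Set.univ E).symm.trans
        ((Homeomorph.setCongr (OpenPartialHomeomorph.univBall_source 0 R).symm).trans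
          ((OpenPartialHomeomorph.univBall (0 : E) R).toHomeomorphSourceTarget.trans
            (Homeomorph.setCongr (OpenPartialHomeomorph.univBall_target 0 hR))))
    exact e₁.trans (e₂.symm.trans (Module.finBasis ℝ E).equivFunL.toHomeomorph)
  · rw [← Real.dimH_of_mem_nhds (ball_mem_nhds (0 : E) hR)]
    refine le_antisymm ?_ ?_
    · rw [← himg']
      exact hg.dimH_image_le
    · rw [← himg]
      exact hf.dimH_image_le

theorem isOpen_setOf_isManifoldPoint {X : Type*} [TopologicalSpace X] (k : ℕ) :
    IsOpen {p : X | IsManifoldPoint k p} := by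
  refine isOpen_iff_forall_mem_open.2 fun p hp => ?_
  obtain ⟨U, hU, hpU, e⟩ := hp
  exact ⟨U, fun q hq => ⟨U, hU, hq, e⟩, hU, hpU⟩

theorem ae_isManifoldPoint {X : Type*} [MetricSpace X] [ProperSpace X] [MeasurableSpace X]
    [BorelSpace X] {n : ℝ} (hn : 1 ≤ n) {K : ℝ} (hK : K ≤ 0) (h : LocalBusemannMCP X (μH[n]) K n) :
    ∀ᵐ x : X ∂μH[n], ∃ k : ℕ, (k : ℝ) = n ∧ IsManifoldPoint k x := by
  obtain ⟨hfin, hpos, hloc⟩ := h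
  have hn0 : 0 < n := by linarith
  have : NullSingletonClass (μH[n] : Measure X) := Measure.nullSingletonClass_hausdorff X hn0
  have hstr : ∀ x : X, ∃ r₀ > 0, ∃ L : LocalGeodesicStructure X (ball x r₀),
      VolumeContraction μH[n] n L ∧ ∀ p ∈ ball x r₀, ∀ y ∈ ball x r₀, ∀ z ∈ ball x r₀,
        ∀ t ∈ Set.Icc (0 : ℝ) 1, dist (L.σ p y t) (L.σ p z t) ≤ t * dist y z := fun x => by
    obtain ⟨r₀, hr₀, L, hconv, hmcp⟩ := hloc x
    exact ⟨r₀, hr₀, L, volumeContraction_of_mcp hn hK hr₀ L hmcp, hconv⟩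
  have hBG : ∀ x : X, AsymptoticBishopGromov μH[n] n x := fun x => by
    obtain ⟨r₀, hr₀, L, hV, -⟩ := hstr x
    exact hV.asymptoticBishopGromov hr₀
  filter_upwards [ae_exists_isRegularPoint hn0 hBG] with x hx
  obtain ⟨θ, hx⟩ := hx
  obtain ⟨r₀, hr₀, L, hV, hconv⟩ := hstr x
  obtain ⟨E, _, _, C, R, f, hC, hR, hnorm, hdist, hsurj⟩ :=
    (hx.asymptoticDilations hn0 hr₀ hV hconv).exists_chart hr₀ (hx.injective hn0 hr₀ hV hconv)
      (hx.exists_preimage hr₀ hV hconv)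
  obtain ⟨k, hk, hdim⟩ := isManifoldPoint_of_chart hC hR hnorm hdist hsurj
  refine ⟨k, ?_, hk⟩
  have hn' : ((Real.toNNReal n : NNReal) : ℝ) = n := Real.coe_toNNReal n hn0.le
  have h1 := dimH_of_hausdorffMeasure_ne_zero_ne_top (d := Real.toNNReal n) (s := ball x R)
    (by rw [hn']; exact (measure_ball_pos _ x hR).ne') (by rw [hn']; exact measure_ball_lt_top.ne)
  rw [hdim] at h1
  rw [← hn']
  exact_mod_cast h1

end BusemannMCP

theorem busemann_mcp_manifold_points_open_dense_full_measure
    (n : ℝ) (hn : 1 ≤ n)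
    (X : Type*) [MetricSpace X] [Nonempty X] [CompleteSpace X] [ProperSpace X]
    [MeasurableSpace X] [BorelSpace X]
    (hgeo : IsGeodesicMetricSpace X)
    (K : ℝ) (hK : K ≤ 0)
    (h : LocalBusemannMCP X (μH[n]) K n) :
    ∃ k : ℕ, (k : ℝ) = n ∧
      IsOpen {p : X | IsManifoldPoint k p} ∧
      Dense {p : X | IsManifoldPoint k p} ∧
      μH[n] {p : X | ¬ IsManifoldPoint k p} = 0 := by
  have hae := BusemannMCP.ae_isManifoldPoint hn hK h
  have : (μH[n] : Measure X).IsOpenPosMeasure := h.2.1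
  obtain ⟨x, k, hk, -⟩ := (Measure.dense_of_ae hae).nonempty
  have hae' : ∀ᵐ x : X ∂μH[n], IsManifoldPoint k x := by
    filter_upwards [hae] with y hy
    obtain ⟨j, hj, hy⟩ := hy
    obtain rfl : j = k := Nat.cast_injective (hj.trans hk.symm)
    exact hy
  exact ⟨k, hk, BusemannMCP.isOpen_setOf_isManifoldPoint k, Measure.dense_of_ae hae', hae'⟩
end

section
/- For every real ε ∈ (0,1) and every real n ≥ 1 there exists δ ∈ (0,1) with the following property. Let X be a complete metric space with a geodesic structure σ that is Busemann convex, let p ∈ X and R > 0, suppose geodesics from ball p R extend to length 9R with respect to σ, suppose the n-dimensional Hausdorff measure μH n is locally finite with 0 < μH n (ball p R) < ∞, and suppose the δ-almost MCP(0,n) holds: μH n (Φ_t^{p'} '' A) ≥ (1−δ)·t^n·μH n A for every p' ∈ X, every Borel set A ⊆ X and every t ∈ [0,1]. Then for all x, y ∈ ball p R and all t ∈ [0,1]: (1−ε)·t·dist x y ≤ dist (σ p x t) (σ p y t) ≤ t·dist x y. -/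
open Metric MeasureTheory ENNReal Filter

/-- A geodesic structure on a metric space. -/
structure GeodesicStructure (X : Type*) [MetricSpace X] where
  σ : X → X → ℝ → X
  σ_zero : ∀ x y, σ x y 0 = x
  σ_one : ∀ x y, σ x y 1 = y
  dist_σ : ∀ x y, ∀ s ∈ Set.Icc (0:ℝ) 1, ∀ t ∈ Set.Icc (0:ℝ) 1,
    dist (σ x y s) (σ x y t) = |s - t| * dist x y
  σ_comp : ∀ x y, ∀ s ∈ Set.Icc (0:ℝ) 1, ∀ t ∈ Set.Icc (0:ℝ) 1,
    σ x (σ x y t) s = σ x y (s * t)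

/-- Busemann convexity of a geodesic structure. -/
def GeodesicStructure.BusemannConvex {X : Type*} [MetricSpace X]
    (G : GeodesicStructure X) : Prop :=
  ∀ p x y : X, ∀ t ∈ Set.Icc (0:ℝ) 1, dist (G.σ p x t) (G.σ p y t) ≤ t * dist x y

/-- Geodesic completeness with respect to a geodesic structure. -/
def GeodesicStructure.GeodComplete {X : Type*} [MetricSpace X]
    (G : GeodesicStructure X) : Prop :=
  ∀ x y : X, x ≠ y → ∀ R : ℝ, dist x y ≤ R →
    ∃ z : X, dist x z = R ∧ G.σ x z (dist x y / R) = y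

/-- The measure contraction property MCP(0,N) with respect to a geodesic structure. -/
def GeodesicStructure.MCPzero {X : Type*} [MetricSpace X] [MeasurableSpace X]
    (G : GeodesicStructure X) (m : Measure X) (N : ℝ) : Prop :=
  ∀ p : X, ∀ A : Set X, MeasurableSet A → ∀ t ∈ Set.Icc (0:ℝ) 1,
    ENNReal.ofReal (t ^ N) * m A ≤ m ((fun x => G.σ p x t) '' A)

/-- Geodesics from `ball q R` extend to length `9R` with respect to `G`. -/
def ExtendsTo {X : Type*} [MetricSpace X] (G : GeodesicStructure X) (q : X) (R : ℝ) : Prop :=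
  ∀ x ∈ Metric.ball q R, ∀ y : X, 0 < dist x y → dist x y ≤ 9 * R →
    ∀ s : ℝ, dist x y ≤ s → s ≤ 9 * R →
      ∃ z : X, dist x z = s ∧ G.σ x z (dist x y / s) = y

namespace GeodesicStructure

variable {X : Type*} [MetricSpace X] (G : GeodesicStructure X)

lemma dist_left (x y : X) {t : ℝ} (ht : t ∈ Set.Icc (0 : ℝ) 1) :
    dist x (G.σ x y t) = t * dist x y := by
  have h := G.dist_σ x y 0 (by simp) t ht
  rwa [G.σ_zero, zero_sub, abs_neg, abs_of_nonneg ht.1] at h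

lemma dist_right (x y : X) {t : ℝ} (ht : t ∈ Set.Icc (0 : ℝ) 1) :
    dist (G.σ x y t) y = (1 - t) * dist x y := by
  have h := G.dist_σ x y t ht 1 (by simp)
  rwa [G.σ_one, abs_sub_comm, abs_of_nonneg (by linarith [ht.2])] at h

lemma σ_self (x : X) {t : ℝ} (ht : t ∈ Set.Icc (0 : ℝ) 1) : G.σ x x t = x := by
  have h := G.dist_left x x ht
  rw [dist_self, mul_zero] at h
  exact (dist_eq_zero.1 h).symm

variable {G}

/-- Balls are geodesically convex. -/
lemma BusemannConvex.σ_mem_ball (hB : G.BusemannConvex) {p a b : X} {R : ℝ}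
    (ha : a ∈ ball p R) (hb : b ∈ ball p R) {t : ℝ} (ht : t ∈ Set.Icc (0 : ℝ) 1) :
    G.σ a b t ∈ ball p R := by
  rw [mem_ball] at *
  have h₁ := hB a b p t ht
  have h₂ := G.dist_right a p ht
  have h₃ := dist_triangle (G.σ a b t) (G.σ a p t) p
  obtain ⟨h0, h1⟩ := ht
  rcases h0.eq_or_lt with rfl | h0
  · linarith
  · nlinarith

lemma BusemannConvex.image_ball_subset (hB : G.BusemannConvex) (q x : X) (r : ℝ)
    {t : ℝ} (ht : t ∈ Set.Ioc (0 : ℝ) 1) :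
    (fun z => G.σ q z t) '' ball x r ⊆ ball (G.σ q x t) (t * r) := by
  rintro _ ⟨z, hz, rfl⟩
  exact (hB q z x t ⟨ht.1.le, ht.2⟩).trans_lt (mul_lt_mul_of_pos_left hz ht.1)

lemma BusemannConvex.hausdorffMeasure_image_le [MeasurableSpace X] [BorelSpace X]
    (hB : G.BusemannConvex) {n : ℝ} (hn : 0 ≤ n) (q : X) (A : Set X)
    {t : ℝ} (ht : t ∈ Set.Icc (0 : ℝ) 1) :
    μH[n] ((fun z => G.σ q z t) '' A) ≤ ENNReal.ofReal (t ^ n) * μH[n] A := by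
  have hL : LipschitzOnWith t.toNNReal (fun z => G.σ q z t) A :=
    LipschitzOnWith.of_dist_le_mul fun x _ y _ => by
      simpa [Real.coe_toNNReal _ ht.1] using hB q x y t ht
  refine (hL.hausdorffMeasure_image_le hn).trans_eq ?_
  rw [← ENNReal.ofReal_rpow_of_nonneg ht.1 hn]
  rfl

end GeodesicStructure

lemma ExtendsTo.ball_subset_image {X : Type*} [MetricSpace X] {G : GeodesicStructure X}
    {p : X} {R : ℝ} (hE : ExtendsTo G p R) {x : X} (hx : x ∈ ball p R) {r : ℝ} (hr : r ≤ 9 * R)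
    {t : ℝ} (ht : t ∈ Set.Ioc (0 : ℝ) 1) :
    ball x (t * r) ⊆ (fun z => G.σ x z t) '' ball x r := by
  intro z hz
  have ht' : t ∈ Set.Icc (0 : ℝ) 1 := ⟨ht.1.le, ht.2⟩
  rw [mem_ball'] at hz
  have hr0 : 0 < r := pos_of_mul_pos_right (dist_nonneg.trans_lt hz) ht.1.le
  rcases eq_or_ne x z with rfl | hne
  · exact ⟨x, mem_ball_self hr0, G.σ_self x ht'⟩
  have hd : 0 < dist x z := dist_pos.2 hne
  have hs : dist x z / t < r := (div_lt_iff₀' ht.1).2 hz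
  have hle : dist x z ≤ dist x z / t := le_div_self hd.le ht.1 ht.2
  obtain ⟨w, hw, hσ⟩ := hE x hx z hd (by linarith) (dist x z / t) hle (by linarith)
  refine ⟨w, by rw [mem_ball', hw]; exact hs, ?_⟩
  rwa [div_div_cancel₀ hd.ne'] at hσ

/-- The measure contraction property `MCP(0, n)` up to the factor `c`. -/
def GeodesicStructure.AlmostMCP {X : Type*} [MetricSpace X] [MeasurableSpace X]
    (G : GeodesicStructure X) (m : Measure X) (c n : ℝ) : Prop :=
  ∀ q : X, ∀ A : Set X, MeasurableSet A → ∀ t ∈ Set.Icc (0 : ℝ) 1,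
    ENNReal.ofReal (c * t ^ n) * m A ≤ m ((fun x => G.σ q x t) '' A)

section Balls

variable {X : Type*} [MetricSpace X] [MeasurableSpace X] [BorelSpace X]
  {G : GeodesicStructure X} {c n : ℝ}

lemma GeodesicStructure.AlmostMCP.le_measure_ball {m : Measure X} (hM : G.AlmostMCP m c n)
    (hB : G.BusemannConvex) (x : X) (r : ℝ) {t : ℝ} (ht : t ∈ Set.Ioc (0 : ℝ) 1) :
    ENNReal.ofReal (c * t ^ n) * m (ball x r) ≤ m (ball x (t * r)) := by
  refine (hM x _ measurableSet_ball t ⟨ht.1.le, ht.2⟩).trans (measure_mono ?_)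
  simpa only [G.σ_self x ⟨ht.1.le, ht.2⟩] using hB.image_ball_subset x x r ht

lemma GeodesicStructure.AlmostMCP.measure_ball_lt_top {m : Measure X} (hM : G.AlmostMCP m c n)
    (hB : G.BusemannConvex) (hc : 0 < c) {p : X} {R : ℝ} (hR : 0 < R)
    (hfin : m (ball p R) < ⊤) (x : X) (r : ℝ) : m (ball x r) < ⊤ := by
  set L := |r| + dist x p + R
  have hd := dist_nonneg (x := x) (y := p)
  have hr := abs_nonneg r
  have hL0 : 0 < L := by positivity
  have ht : R / L ∈ Set.Ioc (0 : ℝ) 1 :=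
    ⟨div_pos hR hL0, (div_le_one hL0).2 (by linarith)⟩
  have h := hM.le_measure_ball hB p L ht
  rw [div_mul_cancel₀ _ hL0.ne'] at h
  have hsub : ball x r ⊆ ball p L := ball_subset_ball' (by linarith [le_abs_self r])
  refine (measure_mono hsub).trans_lt (lt_top_of_mul_ne_top_right (h.trans_lt hfin).ne ?_)
  have : 0 < c * (R / L) ^ n := mul_pos hc (Real.rpow_pos_of_pos ht.1 n)
  exact (ENNReal.ofReal_pos.2 this).ne'

lemma GeodesicStructure.AlmostMCP.measure_ball_pos {m : Measure X} (hM : G.AlmostMCP m c n)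
    (hB : G.BusemannConvex) (hc : 0 < c) {p : X} {R : ℝ} (hR : 0 < R)
    (hpos : 0 < m (ball p R)) (x : X) {r : ℝ} (hr : 0 < r) : 0 < m (ball x r) := by
  set L := r + dist p x + R
  have hd := dist_nonneg (x := p) (y := x)
  have hL0 : 0 < L := by positivity
  have ht : r / L ∈ Set.Ioc (0 : ℝ) 1 :=
    ⟨div_pos hr hL0, (div_le_one hL0).2 (by linarith)⟩
  have h := hM.le_measure_ball hB x L ht
  rw [div_mul_cancel₀ _ hL0.ne'] at h
  have hsub : ball p R ⊆ ball x L := ball_subset_ball' (by linarith)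
  have : 0 < c * (r / L) ^ n := mul_pos hc (Real.rpow_pos_of_pos ht.1 n)
  exact (ENNReal.mul_pos (ENNReal.ofReal_pos.2 this).ne'
    (hpos.trans_le (measure_mono hsub)).ne').trans_le h

lemma ExtendsTo.hausdorffMeasure_ball_le {p : X} {R : ℝ} (hE : ExtendsTo G p R)
    (hB : G.BusemannConvex) (hn : 0 ≤ n) {x : X} (hx : x ∈ ball p R) {r : ℝ} (hr : r ≤ 9 * R)
    {t : ℝ} (ht : t ∈ Set.Ioc (0 : ℝ) 1) :
    μH[n] (ball x (t * r)) ≤ ENNReal.ofReal (t ^ n) * μH[n] (ball x r) :=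
  (measure_mono (hE.ball_subset_image hx hr ht)).trans
    (hB.hausdorffMeasure_image_le hn x _ ⟨ht.1.le, ht.2⟩)

/-- Balls of equal radii have comparable Hausdorff measures: contracting `ball x r` towards `y` by
a small factor lands it in a small ball centered near `y`, which is then blown up. -/
lemma GeodesicStructure.AlmostMCP.le_hausdorffMeasure_ball (hM : G.AlmostMCP μH[n] c n)
    (hB : G.BusemannConvex) (hn : 0 ≤ n) (hc : 0 < c) {p : X} {R : ℝ} (hE : ExtendsTo G p R)
    (x : X) {y : X} (hy : y ∈ ball p R) {r : ℝ} (hr : r ≤ 9 * R) :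
    ENNReal.ofReal c * μH[n] (ball x r) ≤ μH[n] (ball y r) := by
  have key : ∀ s < r, ENNReal.ofReal c * μH[n] (ball x s) ≤ μH[n] (ball y r) := by
    intro s hs
    have hlim : Tendsto (fun t : ℝ => t * dist y x) (nhdsWithin 0 (Set.Ioi 0)) (nhds 0) :=
      tendsto_nhdsWithin_of_tendsto_nhds
        ((continuous_id.mul continuous_const).tendsto' _ _ (zero_mul _))
    have hy' : 0 < R - dist y p := sub_pos.2 hy
    have ht1 : ∀ᶠ t : ℝ in nhdsWithin 0 (Set.Ioi 0), t ∈ Set.Ioc (0 : ℝ) 1 :=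
      Ioc_mem_nhdsGT one_pos
    obtain ⟨t, ⟨ht, htr⟩, htR⟩ := ((ht1.and (hlim.eventually_lt_const (sub_pos.2 hs))).and
      (hlim.eventually_lt_const hy')).exists
    have ht' : t ∈ Set.Icc (0 : ℝ) 1 := ⟨ht.1.le, ht.2⟩
    set q := G.σ y x t with hq
    have hqy : dist q y = t * dist y x := by rw [dist_comm, hq, G.dist_left y x ht']
    have hqp : q ∈ ball p R := by
      rw [mem_ball]
      linarith [dist_triangle q y p]
    have h := calc
      ENNReal.ofReal (t ^ n) * (ENNReal.ofReal c * μH[n] (ball x s))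
          = ENNReal.ofReal (c * t ^ n) * μH[n] (ball x s) := by
            rw [ENNReal.ofReal_mul hc.le, ← mul_assoc, mul_comm (ENNReal.ofReal c)]
      _ ≤ μH[n] ((fun z => G.σ y z t) '' ball x s) := hM y _ measurableSet_ball t ht'
      _ ≤ μH[n] (ball q (t * s)) := measure_mono (hB.image_ball_subset y x s ht)
      _ ≤ ENNReal.ofReal (t ^ n) * μH[n] (ball q s) :=
            hE.hausdorffMeasure_ball_le hB hn hqp (by linarith) ht
      _ ≤ ENNReal.ofReal (t ^ n) * μH[n] (ball y r) := by
            gcongr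
            exact ball_subset_ball' (by linarith)
    exact (ENNReal.mul_le_mul_iff_right
      (ENNReal.ofReal_pos.2 (Real.rpow_pos_of_pos ht.1 n)).ne' ENNReal.ofReal_ne_top).1 h
  obtain ⟨u, hu, hur, hulim⟩ := exists_seq_strictMono_tendsto r
  have hU : ball x r = ⋃ k, ball x (u k) := by
    ext z
    simp only [mem_ball, Set.mem_iUnion]
    exact ⟨fun h => (hulim.eventually_const_lt h).exists, fun ⟨k, hk⟩ => hk.trans (hur k)⟩
  have hmono : Monotone fun k => ball x (u k) := fun i j hij => ball_subset_ball (hu.monotone hij)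
  rw [hU, hmono.measure_iUnion, ENNReal.mul_iSup]
  exact iSup_le fun k => key _ (hur k)

/-- If two balls of radius `r` are disjoint but the contracted centers are at distance less than
`2 * ((1 - ε) * t * r)`, then the measure lost in the overlap of the contracted balls is bounded
by the defect of `c` from `1`. -/
lemma GeodesicStructure.AlmostMCP.overlap_bound (hM : G.AlmostMCP μH[n] c n)
    (hB : G.BusemannConvex) (hn : 0 ≤ n) (hc : 0 < c) (hc1 : c ≤ 1) {p : X} {R : ℝ} (hR : 0 < R)
    (hE : ExtendsTo G p R) (hpos : 0 < μH[n] (ball p R)) (hfin : μH[n] (ball p R) < ⊤)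
    {x y : X} (hx : x ∈ ball p R) (hy : y ∈ ball p R) {r : ℝ} (hr0 : 0 < r) (hr : r ≤ 9 * R)
    (hxy : 2 * r ≤ dist x y) {ε : ℝ} (hε0 : 0 < ε) (hε1 : ε ≤ 1)
    {t : ℝ} (ht : t ∈ Set.Ioc (0 : ℝ) 1)
    (hlt : dist (G.σ p x t) (G.σ p y t) ≤ 2 * ((1 - ε) * t * r)) :
    c ^ 4 * ε ^ n ≤ (1 - c ^ 2) * (1 + c) := by
  have ht' : t ∈ Set.Icc (0 : ℝ) 1 := ⟨ht.1.le, ht.2⟩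
  have hp : p ∈ ball p R := mem_ball_self hR
  have hne : ∀ z s, μH[n] (ball z s) ≠ ⊤ := fun z s =>
    (hM.measure_ball_lt_top hB hc hR hfin z s).ne
  set V : X → ℝ → ℝ := fun z s => (μH[n] : Measure X).real (ball z s) with hV
  have hcomp : ∀ z, ∀ w ∈ ball p R, c * V z r ≤ V w r := fun z w hw => by
    simpa [hV, Measure.real, hc.le] using
      ENNReal.toReal_mono (hne w r) (hM.le_hausdorffMeasure_ball hB hn hc hE z hw hr)
  have hupper : ∀ w ∈ ball p R, V w (t * r) ≤ t ^ n * V w r := fun w hw => by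
    simpa [hV, Measure.real, Real.rpow_nonneg ht.1.le] using
      ENNReal.toReal_mono (ENNReal.mul_ne_top ENNReal.ofReal_ne_top (hne w r))
        (hE.hausdorffMeasure_ball_le hB hn hw hr ht)
  have hVx : 0 < V x r :=
    ENNReal.toReal_pos (hM.measure_ball_pos hB hc hR hpos x hr0).ne' (hne x r)
  set a := G.σ p x t
  set b := G.σ p y t
  have ha : a ∈ ball p R := hB.σ_mem_ball hp hx ht'
  have hb : b ∈ ball p R := hB.σ_mem_ball hp hy ht'
  have hhalf : (1 / 2 : ℝ) ∈ Set.Icc (0 : ℝ) 1 := by norm_num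
  set q := G.σ a b (1 / 2)
  have hq : q ∈ ball p R := hB.σ_mem_ball ha hb hhalf
  have hqa : dist q a = 1 / 2 * dist a b := by rw [dist_comm, G.dist_left a b hhalf]
  have hqb : dist q b = 1 / 2 * dist a b := by rw [G.dist_right a b hhalf]; ring
  have hsub : ball q (ε * t * r) ⊆ ball a (t * r) ∩ ball b (t * r) :=
    Set.subset_inter (ball_subset_ball' (by linarith)) (ball_subset_ball' (by linarith))
  have hεt : ε * t ∈ Set.Ioc (0 : ℝ) 1 :=
    ⟨mul_pos hε0 ht.1, mul_le_one₀ hε1 ht.1.le ht.2⟩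
  have hinter : c * (ε ^ n * t ^ n) * V q r ≤
      (μH[n] : Measure X).real (ball a (t * r) ∩ ball b (t * r)) := by
    have h := (hM.le_measure_ball hB q r hεt).trans (measure_mono hsub)
    have h' := ENNReal.toReal_mono (measure_inter_lt_top_of_left_ne_top (hne a (t * r))).ne h
    rwa [ENNReal.toReal_mul, ENNReal.toReal_ofReal
      (mul_nonneg hc.le (Real.rpow_nonneg hεt.1.le n)), Real.mul_rpow hε0.le ht.1.le] at h'
  have hunion : c * t ^ n * (V x r + V y r) ≤
      (μH[n] : Measure X).real (ball a (t * r) ∪ ball b (t * r)) := by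
    have himage : (fun z => G.σ p z t) '' (ball x r ∪ ball y r) ⊆
        ball a (t * r) ∪ ball b (t * r) := by
      rw [Set.image_union]
      exact Set.union_subset_union (hB.image_ball_subset p x r ht) (hB.image_ball_subset p y r ht)
    have h := (hM p _ (measurableSet_ball.union measurableSet_ball) t ht').trans
      (measure_mono himage)
    rw [measure_union (ball_disjoint_ball (by linarith)) measurableSet_ball] at h
    have h' := ENNReal.toReal_mono
      (measure_union_lt_top (hne a (t * r)).lt_top (hne b (t * r)).lt_top).ne h
    rwa [ENNReal.toReal_mul, ENNReal.toReal_ofReal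
      (mul_nonneg hc.le (Real.rpow_nonneg ht.1.le n)), ENNReal.toReal_add (hne x r) (hne y r)] at h'
  have hadd := measureReal_union_add_inter (μ := (μH[n] : Measure X)) (s := ball a (t * r))
    (measurableSet_ball (x := b) (ε := t * r)) (hne a (t * r)) (hne b (t * r))
  have hsum : c * (V x r + V y r) + c * ε ^ n * V q r ≤ V a r + V b r := by
    refine le_of_mul_le_mul_left ?_ (Real.rpow_pos_of_pos ht.1 n)
    linarith [hupper a ha, hupper b hb]
  have hεn : 0 ≤ ε ^ n := Real.rpow_nonneg hε0.le n
  have hq' : c * ε ^ n * (c * V x r) ≤ c * ε ^ n * V q r :=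
    mul_le_mul_of_nonneg_left (hcomp x q hq) (by positivity)
  have hmain : c ^ 3 * ε ^ n * V x r ≤ (1 - c ^ 2) * (V x r + V y r) := by
    have h := mul_le_mul_of_nonneg_left (hsum.trans' (add_le_add_right hq' _)) hc.le
    linarith [hcomp a x hx, hcomp b y hy]
  refine le_of_mul_le_mul_right ?_ hVx
  have h₁ := mul_le_mul_of_nonneg_left hmain hc.le
  have h₂ := mul_le_mul_of_nonneg_left (hcomp y x hx)
    (sub_nonneg.2 (pow_le_one₀ (n := 2) hc.le hc1))
  linarith

end Balls

theorem almost_mcp_almost_busemann_concavity :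
    ∀ ε : ℝ, 0 < ε → ε < 1 → ∀ n : ℝ, 1 ≤ n →
      ∃ δ : ℝ, 0 < δ ∧ δ < 1 ∧
        ∀ (X : Type) [MetricSpace X] [CompleteSpace X] [MeasurableSpace X] [BorelSpace X],
          ∀ G : GeodesicStructure X, G.BusemannConvex →
            ∀ (p : X) (R : ℝ), 0 < R → ExtendsTo G p R →
              IsLocallyFiniteMeasure (μH[n] : Measure X) →
              0 < μH[n] (Metric.ball p R) → μH[n] (Metric.ball p R) < ⊤ →
              (∀ p' : X, ∀ A : Set X, MeasurableSet A → ∀ t ∈ Set.Icc (0:ℝ) 1,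
                ENNReal.ofReal ((1 - δ) * t ^ n) * μH[n] A ≤
                  μH[n] ((fun x => G.σ p' x t) '' A)) →
              ∀ x ∈ Metric.ball p R, ∀ y ∈ Metric.ball p R, ∀ t ∈ Set.Icc (0:ℝ) 1,
                (1 - ε) * t * dist x y ≤ dist (G.σ p x t) (G.σ p y t) ∧
                  dist (G.σ p x t) (G.σ p y t) ≤ t * dist x y := by
  intro ε hε0 hε1 n hn
  have hεn : 0 < ε ^ n := Real.rpow_pos_of_pos hε0 n
  have hεn1 : ε ^ n ≤ 1 := Real.rpow_le_one hε0.le hε1.le (by linarith)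
  set δ := ε ^ n / 100 with hδ
  refine ⟨δ, by positivity, by linarith, ?_⟩
  intro X _ _ _ _ G hB p R hR hE _ hpos hfin hM x hx y hy t ht
  refine ⟨?_, hB p x y t ht⟩
  rcases ht.1.eq_or_lt with rfl | ht0
  · simp [dist_nonneg]
  rcases eq_or_ne x y with rfl | hxy
  · simp
  by_contra! hlt
  have hd : 0 < dist x y := dist_pos.2 hxy
  have hd2 : dist x y < R + R := by
    linarith [dist_triangle_right x y p, mem_ball.1 hx, mem_ball.1 hy]
  have h := GeodesicStructure.AlmostMCP.overlap_bound (c := 1 - δ) hM hB (by linarith)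
    (by linarith) (by linarith) hR hE hpos hfin hx hy (half_pos hd) (by linarith) (by linarith)
    hε0 hε1.le ⟨ht0, ht.2⟩ (by linarith)
  have hδ0 : 0 < δ := by positivity
  have hc4 : (1 / 2 : ℝ) ≤ (1 - δ) ^ 4 :=
    (pow_le_pow_left₀ (by norm_num) (by linarith : (99 / 100 : ℝ) ≤ 1 - δ) 4).trans'
      (by norm_num)
  nlinarith [mul_le_mul_of_nonneg_right hc4 hεn.le, mul_pos hδ0 hδ0]
end
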